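/- arXiv:1209.3666 — 8 statements merged into one kernel-verified Lean document; each statement's English description precedes it below -/
import Mathlib

section
/- Let a, b, c ∈ ℝ with a + b ≠ 0, set p := (c+b)/(a+b), and assume p > 0 and (p − 1/2)((b−a)p − b) > 0. Set η₀ := 3(1−2p)/(2p) and let ε ∈ {−1, 1}. Then 2η₀/(3(a−b) + 2b(η₀+3)) > 0, and with λ := (1/2)·√(2η₀/(3(a−b)+2b(η₀+3))), w := ε(3+2η₀)/√(3(3+η₀)), B := ε√(3/(3+η₀)), the functions φ(x) = η₀·sech²(λx) and ψ(x) = B·η₀·sech²(λx) satisfy, for every x ∈ ℝ: φ(x) + c·φ''(x) − w·(ψ(x) − b·ψ''(x)) + ψ(x)²/2 = 0 and −w·(φ(x) − b·φ''(x)) + ψ(x) + a·ψ''(x) + φ(x)·ψ(x) = 0. -/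
open Real

/-- The second derivative of `A sech² (k x)` is `4 k² A sech² (k x) - 6 k² A sech⁴ (k x)`. -/
theorem deriv_deriv_const_mul_sech_sq (A k x : ℝ) :
    deriv (deriv fun x => A * (1 / Real.cosh (k * x)) ^ 2) x =
      A * (4 * k ^ 2 * (1 / Real.cosh (k * x)) ^ 2
        - 6 * k ^ 2 * ((1 / Real.cosh (k * x)) ^ 2) ^ 2) := by
  have hlin (y : ℝ) : HasDerivAt (fun x => k * x) k y := by
    simpa using (hasDerivAt_id y).const_mul k
  have hcosh (y : ℝ) : HasDerivAt (fun x => Real.cosh (k * x)) (Real.sinh (k * y) * k) y :=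
    (hlin y).cosh
  have hsinh (y : ℝ) : HasDerivAt (fun x => Real.sinh (k * x)) (Real.cosh (k * y) * k) y :=
    (hlin y).sinh
  have hne (y : ℝ) : Real.cosh (k * y) ≠ 0 := (Real.cosh_pos _).ne'
  have hderiv : deriv (fun x => A * (1 / Real.cosh (k * x)) ^ 2) =
      fun x => -2 * A * k * (Real.sinh (k * x) / Real.cosh (k * x) ^ 3) := by
    funext y
    have h := ((((hcosh y).fun_inv (hne y)).fun_pow 2).const_mul A).deriv
    simp only [one_div]
    rw [h]
    have := hne y
    simp only [Nat.cast_ofNat, Nat.add_one_sub_one, pow_one]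
    field_simp
  rw [hderiv]
  have h := (((hsinh x).fun_div ((hcosh x).fun_pow 3) (pow_ne_zero 3 (hne x))).const_mul
    (-2 * A * k)).deriv
  rw [h]
  have hx := hne x
  have hsq := Real.cosh_sq (k * x)
  field_simp
  push_cast
  linear_combination (-6 * A * k ^ 2 * Real.cosh (k * x) ^ 2) * hsq

theorem stmt_0 (a b c : ℝ) (hab : a + b ≠ 0)
    (p : ℝ) (hp : p = (c + b) / (a + b)) (hp0 : 0 < p)
    (hcond : (p - 1/2) * ((b - a) * p - b) > 0)
    (η₀ : ℝ) (hη : η₀ = 3 * (1 - 2*p) / (2*p))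
    (ε : ℝ) (hε : ε = -1 ∨ ε = 1) :
    0 < 2 * η₀ / (3*(a - b) + 2*b*(η₀ + 3)) ∧
    ∀ (lam w B : ℝ),
      lam = (1/2) * Real.sqrt (2 * η₀ / (3*(a - b) + 2*b*(η₀ + 3))) →
      w = ε * (3 + 2*η₀) / Real.sqrt (3 * (3 + η₀)) →
      B = ε * Real.sqrt (3 / (3 + η₀)) →
      ∀ φ ψ : ℝ → ℝ,
        (φ = fun x => η₀ * (1 / Real.cosh (lam * x))^2) →
        (ψ = fun x => B * η₀ * (1 / Real.cosh (lam * x))^2) →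
        ∀ x : ℝ,
          φ x + c * deriv (deriv φ) x - w * (ψ x - b * deriv (deriv ψ) x) + (ψ x)^2 / 2 = 0 ∧
          -w * (φ x - b * deriv (deriv φ) x) + ψ x + a * deriv (deriv ψ) x + φ x * ψ x = 0 := by
  have hr : 0 < 2 * p := by linarith
  have hη3 : 3 + η₀ = 3 / (2 * p) := by
    rw [hη]; field_simp; ring
  have hq : (b - a) * p - b ≠ 0 := fun h => by simp [h] at hcond
  have hc : c = p * (a + b) - b := by
    rw [hp]; field_simp; ring
  have hK : 2 * η₀ / (3 * (a - b) + 2 * b * (η₀ + 3)) =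
      2 * (p - 1 / 2) / ((b - a) * p - b) := by
    have hden : 3 * (a - b) + 2 * b * (η₀ + 3) = -3 * ((b - a) * p - b) / p := by
      rw [add_comm η₀, hη3]; field_simp; ring
    rw [hden, hη]
    field_simp
    ring
  have hKpos : 0 < 2 * η₀ / (3 * (a - b) + 2 * b * (η₀ + 3)) := by
    rw [hK, mul_div_assoc]
    have : 0 < (p - 1 / 2) / ((b - a) * p - b) := by
      rcases mul_pos_iff.mp hcond with h | h
      · exact div_pos h.1 h.2
      · exact div_pos_of_neg_of_neg h.1 h.2
    linarith
  refine ⟨hKpos, ?_⟩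
  intro lam w B hlam hw hB φ ψ hφ hψ x
  have hlamsq : 4 * lam ^ 2 * ((b - a) * p - b) = 2 * p - 1 := by
    rw [hlam, mul_pow, Real.sq_sqrt hKpos.le, hK]
    linear_combination div_mul_cancel₀ (2 * (p - 1 / 2)) hq
  have hε2 : ε ^ 2 = 1 := by rcases hε with rfl | rfl <;> norm_num
  have hB' : B = ε * Real.sqrt (2 * p) := by
    rw [hB, hη3]; congr 2; field_simp
  have hB2 : B ^ 2 = 2 * p := by
    rw [hB', mul_pow, hε2, Real.sq_sqrt hr.le, one_mul]
  have hwB : p * w = (1 - p) * B := by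
    have hsqrt : Real.sqrt (3 * (3 + η₀)) = 3 / Real.sqrt (2 * p) := by
      rw [hη3, show 3 * (3 / (2 * p)) = 3 ^ 2 / (2 * p) by ring,
        Real.sqrt_div (by norm_num), Real.sqrt_sq (by norm_num)]
    have := (Real.sqrt_pos.mpr hr).ne'
    rw [hw, hsqrt, hB', hη]
    field_simp
    ring
  have hpη : 2 * p * η₀ = 3 * (1 - 2 * p) := by
    rw [hη]; field_simp
  have hwB2 : w * B = 2 * (1 - p) := by
    apply mul_left_cancel₀ hp0.ne'
    linear_combination B * hwB + (1 - p) * hB2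
  have hφ2 := deriv_deriv_const_mul_sech_sq η₀ lam x
  have hψ2 := deriv_deriv_const_mul_sech_sq (B * η₀) lam x
  rw [← hφ] at hφ2
  rw [← hψ] at hψ2
  rw [hφ2, hψ2, hφ, hψ]
  beta_reduce
  generalize (1 / Real.cosh (lam * x)) ^ 2 = s
  constructor
  · rw [hc]
    linear_combination (-η₀ * (s - b * (4 * lam ^ 2 * s - 6 * lam ^ 2 * s ^ 2))) * hwB2
      + η₀ ^ 2 * s ^ 2 / 2 * hB2 + (-η₀ * s + 3 / 2 * η₀ * s ^ 2) * hlamsq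
      + η₀ * s ^ 2 / 2 * hpη
  · apply mul_left_cancel₀ hp0.ne'
    linear_combination (-η₀ * (s - b * (4 * lam ^ 2 * s - 6 * lam ^ 2 * s ^ 2))) * hwB
      + B * (-η₀ * s + 3 / 2 * η₀ * s ^ 2) * hlamsq
      + B * η₀ * s ^ 2 / 2 * hpη
end

section
/- Let a < 0, c < 0, b ∈ ℝ and w ∈ ℝ with |w| < 1 and |b|·|w| < √(a·c). For ξ ∈ ℝ consider the symmetric 2×2 matrix L₀(ξ) = [[1 − cξ², −w(bξ² + 1)], [−w(bξ² + 1), 1 − aξ²]]. Then (i) for every ξ ∈ ℝ, det L₀(ξ) ≥ (1 − w²) + 2ξ²(√(a·c) − |b|·w²) > 0, and (ii) there exists κ > 0 such that for all ξ ∈ ℝ and all (x, y) ∈ ℝ²: (1 − cξ²)x² − 2w(bξ² + 1)xy + (1 − aξ²)y² ≥ κ(x² + y²). -/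
/-- A binary quadratic form whose off-diagonal entry is at most `r` times the geometric mean of
diagonal entries that are at least `1` is bounded below by `1 - r`. -/
theorem one_sub_mul_le_quadratic_form {P R m r : ℝ} (hP : 1 ≤ P) (hR : 1 ≤ R) (hr0 : 0 ≤ r)
    (hr1 : r ≤ 1) (hm : m ^ 2 ≤ r ^ 2 * (P * R)) (x y : ℝ) :
    (1 - r) * (x ^ 2 + y ^ 2) ≤ P * x ^ 2 - 2 * m * x * y + R * y ^ 2 := by
  have hcross : 2 * m * x * y ≤ r * (P * x ^ 2 + R * y ^ 2) := by
    refine (abs_le_of_sq_le_sq' ?_ (by positivity)).2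
    have h := mul_le_mul_of_nonneg_right hm (by positivity : 0 ≤ 4 * (x ^ 2 * y ^ 2))
    nlinarith [sq_nonneg (r * (P * x ^ 2 - R * y ^ 2))]
  have hx := mul_le_mul_of_nonneg_right hP (sq_nonneg x)
  have hy := mul_le_mul_of_nonneg_right hR (sq_nonneg y)
  nlinarith [mul_le_mul_of_nonneg_left (add_le_add hx hy) (sub_nonneg.2 hr1)]

theorem stmt_3 (a b c w : ℝ) (ha : a < 0) (hc : c < 0)
    (hw : |w| < 1) (hbw : |b| * |w| < Real.sqrt (a * c)) :
    (∀ ξ : ℝ,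
      (1 - c * ξ^2) * (1 - a * ξ^2) - (w * (b * ξ^2 + 1))^2
        ≥ (1 - w^2) + 2 * ξ^2 * (Real.sqrt (a * c) - |b| * w^2) ∧
      0 < (1 - c * ξ^2) * (1 - a * ξ^2) - (w * (b * ξ^2 + 1))^2) ∧
    ∃ κ : ℝ, 0 < κ ∧ ∀ ξ x y : ℝ,
      (1 - c * ξ^2) * x^2 - 2 * w * (b * ξ^2 + 1) * x * y + (1 - a * ξ^2) * y^2
        ≥ κ * (x^2 + y^2) := by
  set s := Real.sqrt (a * c)
  have hs2 : s ^ 2 = a * c := Real.sq_sqrt (mul_pos_of_neg_of_neg ha hc).le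
  have hs0 : 0 < s := Real.sqrt_pos.2 (mul_pos_of_neg_of_neg ha hc)
  have hmean : 2 * s ≤ -a - c := by
    refine (abs_le_of_sq_le_sq' ?_ (by linarith)).2
    nlinarith [sq_nonneg (a - c)]
  have hsymbol (ξ : ℝ) : (1 + s * ξ ^ 2) ^ 2 ≤ (1 - c * ξ ^ 2) * (1 - a * ξ ^ 2) := by
    nlinarith [mul_le_mul_of_nonneg_right hmean (sq_nonneg ξ),
      congrArg (· * ξ ^ 4) hs2]
  have hw2 : w ^ 2 < 1 := (sq_lt_one_iff_abs_lt_one w).2 hw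
  have hbw2 : |b| * w ^ 2 ≤ s := by
    rw [← sq_abs w]
    nlinarith [mul_nonneg (abs_nonneg b) (abs_nonneg w), abs_nonneg w]
  constructor
  · intro ξ
    have hdet : (1 - w ^ 2) + 2 * ξ ^ 2 * (s - |b| * w ^ 2) ≤
        (1 - c * ξ ^ 2) * (1 - a * ξ ^ 2) - (w * (b * ξ ^ 2 + 1)) ^ 2 := by
      have hsq : b ^ 2 * w ^ 2 ≤ s ^ 2 := by
        rw [← sq_abs b, ← sq_abs w, ← mul_pow]
        exact pow_le_pow_left₀ (by positivity) hbw.le 2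
      have h4 := mul_le_mul_of_nonneg_right hsq (by positivity : 0 ≤ ξ ^ 4)
      have h2 := mul_le_mul_of_nonneg_right (le_abs_self b) (by positivity : 0 ≤ w ^ 2 * ξ ^ 2)
      nlinarith [hsymbol ξ]
    refine ⟨hdet, lt_of_lt_of_le ?_ hdet⟩
    have := mul_nonneg (by positivity : 0 ≤ 2 * ξ ^ 2) (sub_nonneg.2 hbw2)
    linarith
  · obtain ⟨r, hwr, hbr, hr1⟩ : ∃ r, |w| ≤ r ∧ |b| * |w| / s ≤ r ∧ r < 1 :=
      ⟨max |w| (|b| * |w| / s), le_max_left _ _, le_max_right _ _,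
        max_lt hw ((div_lt_one hs0).2 hbw)⟩
    have hr0 : 0 ≤ r := (abs_nonneg w).trans hwr
    rw [div_le_iff₀ hs0] at hbr
    refine ⟨1 - r, sub_pos.2 hr1, fun ξ x y => ?_⟩
    have hm : (w * (b * ξ ^ 2 + 1)) ^ 2 ≤ r ^ 2 * ((1 - c * ξ ^ 2) * (1 - a * ξ ^ 2)) := by
      have habs : |w * (b * ξ ^ 2 + 1)| ≤ r * (1 + s * ξ ^ 2) := by
        calc |w * (b * ξ ^ 2 + 1)| ≤ |w| * (|b| * ξ ^ 2 + 1) := by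
              rw [abs_mul]
              gcongr
              have h := abs_add_le (b * ξ ^ 2) 1
              rwa [abs_mul b, abs_of_nonneg (sq_nonneg ξ), abs_one] at h
          _ ≤ r * (1 + s * ξ ^ 2) := by
              nlinarith [mul_le_mul_of_nonneg_right hbr (sq_nonneg ξ)]
      calc (w * (b * ξ ^ 2 + 1)) ^ 2 ≤ (r * (1 + s * ξ ^ 2)) ^ 2 :=
            sq_le_sq.2 (habs.trans (le_abs_self _))
        _ = r ^ 2 * (1 + s * ξ ^ 2) ^ 2 := mul_pow _ _ _
        _ ≤ _ := mul_le_mul_of_nonneg_left (hsymbol ξ) (sq_nonneg r)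
    have hP : 1 ≤ 1 - c * ξ ^ 2 := by nlinarith [sq_nonneg ξ]
    have hR : 1 ≤ 1 - a * ξ ^ 2 := by nlinarith [sq_nonneg ξ]
    simpa only [ge_iff_le, mul_assoc] using one_sub_mul_le_quadratic_form hP hR hr0 hr1.le hm x y
end

section
/- Let α > 0, λ > 0 and Q ∈ ℝ. Then the following are equivalent: (i) for every infinitely differentiable, compactly supported f : ℝ → ℝ one has ∫_ℝ (f'(x)² + α²·f(x)² − Q·sech²(λx)·f(x)²) dx ≥ 0; (ii) α² + α·λ ≥ Q. -/
open MeasureTheory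

/-- Completing the square with the ground state: the quadratic form of the Hill operator equals
the integral of `(f' + α tanh(λx) f)²` plus a multiple of the weighted `L²` norm. -/
theorem integral_hill_eq {α lam : ℝ} (Q : ℝ) {f : ℝ → ℝ}
    (hf : ContDiff ℝ 1 f) (hc : HasCompactSupport f) :
    ∫ x : ℝ, ((deriv f x)^2 + α^2 * (f x)^2 - Q * (1 / Real.cosh (lam * x))^2 * (f x)^2) =
      ∫ x : ℝ, ((deriv f x + α * (Real.sinh (lam * x) / Real.cosh (lam * x)) * f x)^2
        + (α^2 + α * lam - Q) * ((1 / Real.cosh (lam * x))^2 * (f x)^2)) := by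
  have hne (x : ℝ) : Real.cosh (lam * x) ≠ 0 := (Real.cosh_pos _).ne'
  have hf0 : Continuous f := hf.continuous
  have hf1 : Continuous (deriv f) := hf.continuous_deriv le_rfl
  set t : ℝ → ℝ := fun x => Real.sinh (lam * x) / Real.cosh (lam * x) with ht
  set s : ℝ → ℝ := fun x => 1 / Real.cosh (lam * x) with hs
  have htc : Continuous t := by fun_prop (disch := exact hne _)
  have hsc : Continuous s := by fun_prop (disch := exact hne _)
  have hts (x : ℝ) : t x ^ 2 = 1 - s x ^ 2 := by
    have := hne x
    simp only [ht, hs]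
    field_simp
    linarith [Real.cosh_sq (lam * x)]
  have htd (x : ℝ) : HasDerivAt t (lam * s x ^ 2) x := by
    have hl : HasDerivAt (fun y : ℝ => lam * y) lam x := by
      simpa using (hasDerivAt_id x).const_mul lam
    refine (hl.sinh.div hl.cosh (hne x)).congr_deriv ?_
    have := hne x
    simp only [hs]
    field_simp
    linear_combination lam * Real.cosh_sq (lam * x)
  have hgd (x : ℝ) : HasDerivAt (fun y => α * (t y * f y ^ 2))
      (α * (lam * s x ^ 2 * f x ^ 2 + t x * (2 * f x * deriv f x))) x := by
    have := (hf.differentiable one_ne_zero x).hasDerivAt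
    refine (((htd x).mul (this.pow 2)).const_mul α).congr_deriv ?_
    simp
  have hint {g : ℝ → ℝ} (hg : Continuous g) (h0 : ∀ x, f x = 0 → deriv f x = 0 → g x = 0) :
      Integrable g := by
    refine hg.integrable_of_hasCompactSupport (hc.mono' fun x hx => ?_)
    by_contra hx'
    refine hx (h0 x (image_eq_zero_of_notMem_tsupport hx') ?_)
    exact image_eq_zero_of_notMem_tsupport fun h => hx' (tsupport_deriv_subset h)
  have hzero := integral_eq_zero_of_hasDerivAt_of_integrable hgd
    (hint (by fun_prop) (by intro x h h'; simp [h]))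
    (hint (by fun_prop) (by intro x h h'; simp [h]))
  rw [← sub_zero (∫ x : ℝ, ((deriv f x + α * t x * f x)^2 + _)), ← hzero, ← integral_sub]
  · congr 1 with x
    linear_combination (-α ^ 2 * f x ^ 2) * hts x
  · exact hint (by fun_prop) (by intro x h h'; simp [h, h'])
  · exact hint (by fun_prop) (by intro x h h'; simp [h])

/-- The ground state `cosh(λx)^(-α/λ)`. -/
noncomputable def hillGround (α lam x : ℝ) : ℝ :=
  Real.exp (-(α / lam) * Real.log (Real.cosh (lam * x)))

theorem contDiff_hillGround (α lam : ℝ) {n : WithTop ℕ∞} : ContDiff ℝ n (hillGround α lam) := by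
  have hl : ContDiff ℝ n fun x : ℝ => lam * x := by fun_prop
  exact (contDiff_const.mul (hl.cosh.log fun x => (Real.cosh_pos _).ne')).exp

theorem hasDerivAt_hillGround (α : ℝ) {lam : ℝ} (hlam : lam ≠ 0) (x : ℝ) :
    HasDerivAt (hillGround α lam)
      (-(α * (Real.sinh (lam * x) / Real.cosh (lam * x)) * hillGround α lam x)) x := by
  have hl : HasDerivAt (fun y : ℝ => lam * y) lam x := by
    simpa using (hasDerivAt_id x).const_mul lam
  refine ((hl.cosh.log (Real.cosh_pos _).ne').const_mul (-(α / lam))).exp.congr_deriv ?_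
  have := (Real.cosh_pos (lam * x)).ne'
  simp only [hillGround]
  field_simp

theorem hillGround_pos (α lam x : ℝ) : 0 < hillGround α lam x := Real.exp_pos _

theorem hillGround_le_one {α lam : ℝ} (hα : 0 ≤ α) (hlam : 0 ≤ lam) (x : ℝ) :
    hillGround α lam x ≤ 1 := by
  refine Real.exp_le_one_iff.2 ?_
  rw [neg_mul, neg_nonpos]
  exact mul_nonneg (div_nonneg hα hlam) (Real.log_nonneg (Real.one_le_cosh _))

/-- Nonnegativity of the form on the truncated ground states `χ(x/n) cosh(λx)^(-α/λ)` bounds the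
excess of `Q` over the critical value. -/
theorem hill_excess_le {α lam Q : ℝ} (hα : 0 < α) (hlam : 0 < lam)
    (h : ∀ f : ℝ → ℝ, ContDiff ℝ (⊤ : ℕ∞) f → HasCompactSupport f →
      0 ≤ ∫ x : ℝ, ((deriv f x)^2 + α^2 * (f x)^2
          - Q * (1 / Real.cosh (lam * x))^2 * (f x)^2))
    {χ : ℝ → ℝ} (hχ : ContDiff ℝ (⊤ : ℕ∞) χ) (hχc : HasCompactSupport χ) {n : ℝ} (hn : 0 < n) :
    (Q - (α^2 + α * lam)) *
        ∫ x, (1 / Real.cosh (lam * x))^2 * (χ (n⁻¹ * x) * hillGround α lam x)^2 ≤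
      n⁻¹ * ∫ x, (deriv χ x)^2 := by
  have hcosh (x : ℝ) : Real.cosh (lam * x) ≠ 0 := (Real.cosh_pos _).ne'
  have hn' : n⁻¹ ≠ 0 := (inv_pos.2 hn).ne'
  have hφ : ContDiff ℝ (⊤ : ℕ∞) (hillGround α lam) := contDiff_hillGround α lam
  have hφ0 := hφ.continuous
  have hχ0 := hχ.continuous
  have hχ1 : Continuous (deriv χ) := hχ.continuous_deriv (by simp)
  have hη : ContDiff ℝ (⊤ : ℕ∞) fun x => χ (n⁻¹ * x) := hχ.comp (by fun_prop)
  have hηc : HasCompactSupport fun x => χ (n⁻¹ * x) := by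
    simpa [Function.comp_def] using hχc.comp_homeomorph (Homeomorph.mulLeft₀ n⁻¹ hn')
  have hη'c : HasCompactSupport fun x => deriv χ (n⁻¹ * x) := by
    simpa [Function.comp_def] using hχc.deriv.comp_homeomorph (Homeomorph.mulLeft₀ n⁻¹ hn')
  have hηd (x : ℝ) : HasDerivAt (fun y => χ (n⁻¹ * y)) (n⁻¹ * deriv χ (n⁻¹ * x)) x := by
    have hd := (hχ.differentiable (by simp) (n⁻¹ * x)).hasDerivAt
    have hl : HasDerivAt (fun y : ℝ => n⁻¹ * y) n⁻¹ x := by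
      simpa using (hasDerivAt_id x).const_mul n⁻¹
    rw [mul_comm]
    exact hd.comp x hl
  set f : ℝ → ℝ := fun x => χ (n⁻¹ * x) * hillGround α lam x with hf
  have hfC : ContDiff ℝ (⊤ : ℕ∞) f := hη.mul hφ
  have hfc : HasCompactSupport f := hηc.mul_right
  have hf0 := hfC.continuous
  have hfd (x : ℝ) : deriv f x + α * (Real.sinh (lam * x) / Real.cosh (lam * x)) * f x =
      n⁻¹ * deriv χ (n⁻¹ * x) * hillGround α lam x := by
    have hd : HasDerivAt f _ x := (hηd x).mul (hasDerivAt_hillGround α hlam.ne' x)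
    rw [hd.deriv]
    simp only [hf]
    ring
  have key := h f hfC hfc
  rw [integral_hill_eq Q (hfC.of_le (by simp)) hfc] at key
  simp only [hfd] at key
  have hi₁ : Integrable fun x => (n⁻¹ * deriv χ (n⁻¹ * x) * hillGround α lam x)^2 := by
    refine Continuous.integrable_of_hasCompactSupport (by fun_prop) (hη'c.mono fun x hx => ?_)
    contrapose! hx
    simp_all
  have hi₂ : Integrable fun x => (1 / Real.cosh (lam * x))^2 * (f x)^2 := by
    refine Continuous.integrable_of_hasCompactSupport (by fun_prop (disch := exact hcosh _))
      (hfc.mono fun x hx => ?_)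
    contrapose! hx
    simp_all
  have hi₃ : Integrable fun x => n⁻¹^2 * (deriv χ (n⁻¹ * x))^2 := by
    refine Continuous.integrable_of_hasCompactSupport (by fun_prop) (hη'c.mono fun x hx => ?_)
    contrapose! hx
    simp_all
  rw [integral_add hi₁ (hi₂.const_mul _), integral_const_mul] at key
  have hle : ∫ x, (n⁻¹ * deriv χ (n⁻¹ * x) * hillGround α lam x)^2 ≤
      ∫ x, n⁻¹^2 * (deriv χ (n⁻¹ * x))^2 := by
    refine integral_mono hi₁ hi₃ fun x => ?_
    have h1 : hillGround α lam x ^ 2 ≤ 1 :=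
      pow_le_one₀ (hillGround_pos _ _ _).le (hillGround_le_one hα.le hlam.le x)
    have := mul_le_mul_of_nonneg_left h1 (sq_nonneg (n⁻¹ * deriv χ (n⁻¹ * x)))
    simp only [mul_pow] at this ⊢
    linarith
  have hscale : ∫ x, n⁻¹^2 * (deriv χ (n⁻¹ * x))^2 = n⁻¹ * ∫ x, (deriv χ x)^2 := by
    rw [integral_const_mul, Measure.integral_comp_mul_left (fun y => (deriv χ y)^2), inv_inv,
      abs_of_pos hn, smul_eq_mul]
    field_simp
  linarith

theorem stmt_4 (α lam Q : ℝ) (hα : 0 < α) (hlam : 0 < lam) :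
    (∀ f : ℝ → ℝ, ContDiff ℝ (⊤ : ℕ∞) f → HasCompactSupport f →
      0 ≤ ∫ x : ℝ, ((deriv f x)^2 + α^2 * (f x)^2
          - Q * (1 / Real.cosh (lam * x))^2 * (f x)^2)) ↔
    α^2 + α * lam ≥ Q := by
  constructor
  · intro h
    by_contra! hQ
    let χ : ContDiffBump (0 : ℝ) := ⟨1, 2, one_pos, one_lt_two⟩
    have hχ : ContDiff ℝ (⊤ : ℕ∞) χ := χ.contDiff
    have hφ : Continuous (hillGround α lam) := (contDiff_hillGround α lam (n := 0)).continuous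
    have hcosh (x : ℝ) : Real.cosh (lam * x) ≠ 0 := (Real.cosh_pos _).ne'
    set w : ℝ → ℝ → ℝ := fun n x =>
      (1 / Real.cosh (lam * x))^2 * (χ (n⁻¹ * x) * hillGround α lam x)^2 with hw
    have hwc (n : ℝ) : Continuous (w n) := by
      have := χ.continuous
      fun_prop (disch := exact hcosh _)
    have hws {n : ℝ} (hn : 0 < n) : HasCompactSupport (w n) := by
      have : HasCompactSupport fun x => χ (n⁻¹ * x) := by
        simpa [Function.comp_def] using χ.hasCompactSupport.comp_homeomorph
          (Homeomorph.mulLeft₀ n⁻¹ (inv_pos.2 hn).ne')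
      refine this.mono fun x hx => ?_
      contrapose! hx
      simp_all
    have hpos : 0 < ∫ x, w 1 x := by
      refine (hwc 1).integral_pos_of_hasCompactSupport_nonneg_nonzero (hws one_pos)
        (fun x => by positivity) (x := 0) ?_
      have h1 : χ 0 = 1 := χ.one_of_mem_closedBall (by simp [χ])
      simp [hw, h1, (hillGround_pos α lam 0).ne']
    have hmono {n : ℝ} (hn : 2 ≤ n) : ∫ x, w 1 x ≤ ∫ x, w n x := by
      have hn0 : 0 < n := by linarith
      refine integral_mono ((hwc 1).integrable_of_hasCompactSupport (hws one_pos))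
        ((hwc n).integrable_of_hasCompactSupport (hws hn0)) fun x => ?_
      have hle : χ (1⁻¹ * x) ≤ χ (n⁻¹ * x) := by
        rcases le_or_gt 2 |x| with hx | hx
        · rw [χ.zero_of_le_dist (by simpa [χ] using hx)]
          exact χ.nonneg
        · rw [χ.one_of_mem_closedBall (x := n⁻¹ * x)]
          · exact χ.le_one
          · simp only [χ, mem_closedBall_zero_iff, norm_mul, norm_inv, Real.norm_eq_abs,
              abs_of_pos hn0]
            rw [inv_mul_le_one₀ hn0]
            linarith
      have := χ.nonneg (x := 1⁻¹ * x)
      have := (hillGround_pos α lam x).le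
      simp only [hw]
      gcongr
    have hδ : 0 < Q - (α^2 + α * lam) := by linarith
    have hbound : ∀ᶠ n : ℝ in Filter.atTop,
        (Q - (α^2 + α * lam)) * ∫ x, w 1 x ≤ n⁻¹ * ∫ x, (deriv χ x)^2 := by
      filter_upwards [Filter.eventually_ge_atTop 2] with n hn
      exact (mul_le_mul_of_nonneg_left (hmono hn) hδ.le).trans
        (hill_excess_le hα hlam h hχ χ.hasCompactSupport (by linarith))
    have hlim := ge_of_tendsto (tendsto_inv_atTop_zero.mul_const (∫ x, (deriv χ x)^2)) hbound
    rw [zero_mul] at hlim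
    exact (mul_pos hδ hpos).not_ge hlim
  · intro hQ f hf hc
    rw [integral_hill_eq Q (hf.of_le (by simp)) hc]
    refine integral_nonneg fun x => ?_
    have : 0 ≤ α^2 + α * lam - Q := by linarith
    positivity
end

section
/- Let a < 0 and define φ : ℝ → ℝ by φ(x) = −(3/2)·sech²(x/(2√(−a))). Then φ is twice differentiable and for every x ∈ ℝ: a·φ''(x) + φ(x) + φ(x)² = 0. -/
theorem hasDerivAt_sech_sq (c x : ℝ) :
    HasDerivAt (fun x => -(3/2) * (1 / Real.cosh (x / c))^2)
      (3 / c * (Real.sinh (x / c) / Real.cosh (x / c) ^ 3)) x := by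
  have hx : HasDerivAt (fun x : ℝ => x / c) (1 / c) x := (hasDerivAt_id x).div_const c
  have h0 : Real.cosh (x / c) ≠ 0 := (Real.cosh_pos _).ne'
  refine ((((hasDerivAt_const x (1 : ℝ)).fun_div hx.cosh h0).fun_pow 2).const_mul (-(3/2) : ℝ)).congr_deriv ?_
  generalize Real.cosh (x / c) = C at *
  simp only [Nat.add_one_sub_one, pow_one]
  field_simp
  ring

theorem hasDerivAt_sinh_div_cosh_cube (c x : ℝ) :
    HasDerivAt (fun x => 3 / c * (Real.sinh (x / c) / Real.cosh (x / c) ^ 3))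
      (3 / c ^ 2 * (3 - 2 * Real.cosh (x / c) ^ 2) / Real.cosh (x / c) ^ 4) x := by
  have hx : HasDerivAt (fun x : ℝ => x / c) (1 / c) x := (hasDerivAt_id x).div_const c
  have h0 : Real.cosh (x / c) ≠ 0 := (Real.cosh_pos _).ne'
  refine ((hx.sinh.fun_div (hx.cosh.fun_pow 3) (pow_ne_zero 3 h0)).const_mul (3 / c)).congr_deriv ?_
  have hs := Real.sinh_sq (x / c)
  generalize Real.cosh (x / c) = C at *
  generalize Real.sinh (x / c) = S at *
  field_simp
  push_cast
  linear_combination -3 * c⁻¹ ^ 2 * C ^ 2 * hs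

theorem stmt_7 (a : ℝ) (ha : a < 0) (φ : ℝ → ℝ)
    (hφ : φ = fun x => -(3/2) * (1 / Real.cosh (x / (2 * Real.sqrt (-a))))^2) :
    Differentiable ℝ φ ∧ Differentiable ℝ (deriv φ) ∧
    ∀ x : ℝ, a * deriv (deriv φ) x + φ x + (φ x)^2 = 0 := by
  have hc : (2 * Real.sqrt (-a)) ^ 2 = -4 * a := by
    rw [mul_pow, Real.sq_sqrt (by linarith)]
    ring
  generalize 2 * Real.sqrt (-a) = c at hφ hc
  subst hφ
  have hd := funext fun x => (hasDerivAt_sech_sq c x).deriv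
  refine ⟨fun x => (hasDerivAt_sech_sq c x).differentiableAt, ?_, fun x => ?_⟩
  · rw [hd]
    exact fun x => (hasDerivAt_sinh_div_cosh_cube c x).differentiableAt
  · rw [hd, (hasDerivAt_sinh_div_cosh_cube c x).deriv, hc]
    have h0 : Real.cosh (x / c) ≠ 0 := (Real.cosh_pos _).ne'
    have ha' : a ≠ 0 := ha.ne
    field_simp
    ring
end

section
/- Let a < 0 and b ∈ ℝ. Define φ(x) = −(3/2)·sech²(x/(2√(−a))) and φ_a(x) = (3x/(4(−a)^{3/2}))·sech²(x/(2√(−a)))·tanh(x/(2√(−a))), and set h := (a+b)·φ_a − φ. Then for every x ∈ ℝ: a·h''(x) + h(x) + 2φ(x)·h(x) = φ(x) − b·φ''(x). (That is, L_{KdV} h = (1 − b∂ₓ²)φ, so h = L_{KdV}^{−1}[(1 − b∂ₓ²)φ].) -/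
theorem Real.one_div_cosh_sq (x : ℝ) : (1 / Real.cosh x) ^ 2 = 1 - Real.tanh x ^ 2 := by
  have hc := (Real.cosh_pos x).ne'
  rw [Real.tanh_eq_sinh_div_cosh]
  field_simp
  linarith [Real.cosh_sq x]

theorem hasDerivAt_tanh_div (c x : ℝ) :
    HasDerivAt (fun y => Real.tanh (y / c)) ((1 - Real.tanh (x / c) ^ 2) / c) x := by
  have hc := (Real.cosh_pos (x / c)).ne'
  have hlin : HasDerivAt (fun y : ℝ => y / c) (1 / c) x := (hasDerivAt_id x).div_const c
  have h := (hlin.sinh).div (hlin.cosh) hc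
  have heq : (fun y => Real.tanh (y / c)) =
      (fun y => Real.sinh (y / c)) / fun y => Real.cosh (y / c) := by
    funext y
    simp [Real.tanh_eq_sinh_div_cosh]
  rw [heq]
  refine h.congr_deriv ?_
  rw [Real.tanh_eq_sinh_div_cosh]
  field_simp

theorem deriv_deriv_eq_of_hasDerivAt {f f' f'' : ℝ → ℝ} (hf : ∀ x, HasDerivAt f (f' x) x)
    (hf' : ∀ x, HasDerivAt f' (f'' x) x) (x : ℝ) : deriv (deriv f) x = f'' x := by
  rw [show deriv f = f' from funext fun y => (hf y).deriv, (hf' x).deriv]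

theorem stmt_9 (a b : ℝ) (ha : a < 0) (φ φa h : ℝ → ℝ)
    (hφ : φ = fun x => -(3/2) * (1 / Real.cosh (x / (2 * Real.sqrt (-a))))^2)
    (hφa : φa = fun x => (3 * x / (4 * (-a) ^ ((3:ℝ)/2)))
        * (1 / Real.cosh (x / (2 * Real.sqrt (-a))))^2
        * Real.tanh (x / (2 * Real.sqrt (-a))))
    (hh : h = fun x => (a + b) * φa x - φ x) :
    ∀ x : ℝ, a * deriv (deriv h) x + h x + 2 * φ x * h x
      = φ x - b * deriv (deriv φ) x := by
  have hpow : (-a) ^ ((3:ℝ)/2) = Real.sqrt (-a) ^ 3 := by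
    rw [Real.sqrt_eq_rpow, ← Real.rpow_natCast, ← Real.rpow_mul (by linarith)]
    norm_num
  have hs : 0 < Real.sqrt (-a) := Real.sqrt_pos.mpr (by linarith)
  have has : a = -Real.sqrt (-a) ^ 2 := by rw [Real.sq_sqrt (by linarith)]; ring
  rw [hpow] at hφa
  generalize Real.sqrt (-a) = s at *
  subst has
  have hs0 := hs.ne'
  simp only [Real.one_div_cosh_sq] at hφ hφa
  have hT := hasDerivAt_tanh_div (2 * s)
  generalize hTdef : (fun y => Real.tanh (y / (2 * s))) = T at hT
  have hTy : ∀ y, Real.tanh (y / (2 * s)) = T y := fun y => congrFun hTdef y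
  simp only [hTy] at hφ hφa hT
  have dφ : ∀ x, HasDerivAt φ (3 / (2 * s) * (T x - T x ^ 3)) x := fun x => by
    rw [hφ]
    refine ((((hT x).pow 2).const_sub 1).const_mul (-(3/2))).congr_deriv ?_
    field_simp
    ring
  have ddφ : ∀ x, HasDerivAt (fun x => 3 / (2 * s) * (T x - T x ^ 3))
      (3 / (4 * s ^ 2) * (1 - 3 * T x ^ 2) * (1 - T x ^ 2)) x := fun x => by
    refine (((hT x).sub ((hT x).pow 3)).const_mul (3 / (2 * s))).congr_deriv ?_
    field_simp
    ring
  have dφa : ∀ x, HasDerivAt φa (3 / (4 * s ^ 3) * ((T x - T x ^ 3)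
      + x * ((1 - 4 * T x ^ 2 + 3 * T x ^ 4) / (2 * s)))) x := fun x => by
    rw [hφa]
    refine (((((hasDerivAt_id x).const_mul 3).div_const (4 * s ^ 3)).mul
      (((hT x).pow 2).const_sub 1)).mul (hT x)).congr_deriv ?_
    dsimp
    field_simp
    ring
  have ddφa : ∀ x, HasDerivAt (fun x => 3 / (4 * s ^ 3) * ((T x - T x ^ 3)
      + x * ((1 - 4 * T x ^ 2 + 3 * T x ^ 4) / (2 * s))))
      (3 / (4 * s ^ 3) * ((1 - 3 * T x ^ 2) * (1 - T x ^ 2) / s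
        + x * (12 * T x ^ 3 - 8 * T x) * (1 - T x ^ 2) / (4 * s ^ 2))) x := fun x => by
    refine ((((hT x).sub ((hT x).pow 3)).add ((hasDerivAt_id x).mul
      ((((((hT x).pow 2).const_mul 4).const_sub 1).add
        (((hT x).pow 4).const_mul 3)).div_const (2 * s)))).const_mul
          (3 / (4 * s ^ 3))).congr_deriv ?_
    dsimp
    field_simp
    ring
  intro x
  have hφ2 := deriv_deriv_eq_of_hasDerivAt dφ ddφ x
  have hh2 := deriv_deriv_eq_of_hasDerivAt
    (fun x => ((dφa x).const_mul (-s ^ 2 + b)).sub (dφ x))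
    (fun x => ((ddφa x).const_mul (-s ^ 2 + b)).sub (ddφ x)) x
  change deriv (deriv fun x => (-s ^ 2 + b) * φa x - φ x) x = _ at hh2
  rw [← hh] at hh2
  rw [hφ2, hh2, hh, hφ, hφa]
  field_simp
  ring
end

section
/- Let a < 0, let φ(x) = −(3/2)·sech²(x/(2√(−a))), let g : ℝ → ℝ be continuous and square-integrable, and let h : ℝ → ℝ be twice continuously differentiable with h, h', h'' all square-integrable, satisfying a·h''(x) + h(x) − φ(x)·h(x) = g(x) for all x ∈ ℝ. Then ∫_ℝ h(x)² dx ≤ ∫_ℝ h(x)·g(x) dx ≤ ∫_ℝ g(x)² dx. In particular 0 ≤ ∫ h·g ≤ ∫ g². -/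
open MeasureTheory

theorem Continuous.integrable_mul_of_integrable_sq {u v : ℝ → ℝ} (hu : Continuous u)
    (hv : Continuous v) (hu2 : Integrable (fun x => u x ^ 2))
    (hv2 : Integrable (fun x => v x ^ 2)) : Integrable (fun x => u x * v x) :=
  ((memLp_two_iff_integrable_sq hu.aestronglyMeasurable).2 hu2).integrable_mul
    ((memLp_two_iff_integrable_sq hv.aestronglyMeasurable).2 hv2)

theorem stmt_15 (a : ℝ) (ha : a < 0) (φ g h : ℝ → ℝ)
    (hφ : φ = fun x => -(3/2) * (1 / Real.cosh (x / (2 * Real.sqrt (-a))))^2)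
    (hgc : Continuous g) (hg2 : Integrable (fun x => (g x)^2))
    (hh : ContDiff ℝ 2 h)
    (hh2 : Integrable (fun x => (h x)^2))
    (hh'2 : Integrable (fun x => (deriv h x)^2))
    (hh''2 : Integrable (fun x => (deriv (deriv h) x)^2))
    (heq : ∀ x : ℝ, a * deriv (deriv h) x + h x - φ x * h x = g x) :
    (∫ x : ℝ, (h x)^2) ≤ (∫ x : ℝ, h x * g x) ∧
    (∫ x : ℝ, h x * g x) ≤ (∫ x : ℝ, (g x)^2) ∧
    0 ≤ (∫ x : ℝ, h x * g x) := by
  have hh' : ContDiff ℝ 1 (deriv h) := hh.deriv' (n := 1)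
  have c0 : Continuous h := hh.continuous
  have c1 : Continuous (deriv h) := hh'.continuous
  have c2 : Continuous (deriv (deriv h)) := hh'.continuous_deriv le_rfl
  have i02 := c0.integrable_mul_of_integrable_sq c2 hh2 hh''2
  have i11 := c1.integrable_mul_of_integrable_sq c1 hh'2 hh'2
  have i01 := c0.integrable_mul_of_integrable_sq c1 hh2 hh'2
  have i0g := c0.integrable_mul_of_integrable_sq hgc hh2 hg2
  have parts : ∫ x, h x * deriv (deriv h) x = -∫ x, deriv h x * deriv h x :=
    integral_mul_deriv_eq_deriv_mul_of_integrable
      (fun x _ => (hh.differentiable two_ne_zero x).hasDerivAt)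
      (fun x _ => (hh'.differentiable one_ne_zero x).hasDerivAt) i02 i11 i01
  have energy : 0 ≤ ∫ x, deriv h x * deriv h x :=
    integral_nonneg fun x => mul_self_nonneg _
  have φ_nonpos (x : ℝ) : φ x ≤ 0 := by
    rw [hφ]
    nlinarith [sq_nonneg (1 / Real.cosh (x / (2 * Real.sqrt (-a))))]
  have lower : ∫ x, (a * (h x * deriv (deriv h) x) + h x ^ 2) ≤ ∫ x, h x * g x := by
    refine integral_mono ((i02.const_mul a).add hh2) i0g fun x => ?_
    simp only [← heq x]
    nlinarith [mul_nonneg (neg_nonneg.2 (φ_nonpos x)) (sq_nonneg (h x))]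
  rw [integral_add (i02.const_mul a) hh2, integral_const_mul, parts] at lower
  have upper : ∫ x, 2 * (h x * g x) ≤ ∫ x, (h x ^ 2 + g x ^ 2) :=
    integral_mono (i0g.const_mul 2) (hh2.add hg2) fun x => by
      simp only
      nlinarith [sq_nonneg (h x - g x)]
  rw [integral_add hh2 hg2, integral_const_mul] at upper
  have mass : 0 ≤ ∫ x, h x ^ 2 := integral_nonneg fun x => sq_nonneg _
  have coercive : (∫ x, h x ^ 2) ≤ ∫ x, h x * g x := by nlinarith
  exact ⟨coercive, by linarith, mass.trans coercive⟩
end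

section
/- Let a < 0, b > 0, set z := b/(−a), and define φ(x) = −(3/2)·sech²(x/(2√(−a))). Let h : ℝ → ℝ be twice continuously differentiable with h, h', h'' square-integrable, satisfying a·h''(x) + h(x) − φ(x)·h(x) = φ(x) − b·φ''(x) for all x ∈ ℝ. Then √(−a)·(4z² + 46z + 112)/45 ≤ ∫_ℝ h(x)·(φ(x) − b·φ''(x)) dx ≤ √(−a)·( (22/45)z² + (2/9)z + 26/9 ), with strict lower inequality whenever b ≠ −a. -/
open MeasureTheory

open Filter Topology

/-- The profile `tanh (x / (2 s))`, written through the exponential. -/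
noncomputable def tanhProfile (s x : ℝ) : ℝ := 1 - 2 / (1 + Real.exp (x / s))

/-- The profile `sech² (x / (2 s))`, written as `1 - tanh²`. -/
noncomputable def sechSqProfile (s x : ℝ) : ℝ := 1 - tanhProfile s x ^ 2

theorem one_div_cosh_sq_eq_sechSqProfile {s : ℝ} (x : ℝ) :
    (1 / Real.cosh (x / (2 * s))) ^ 2 = sechSqProfile s x := by
  have hE : Real.exp (x / s) = Real.exp (x / (2 * s)) ^ 2 := by
    rw [← Real.exp_nat_mul]
    congr 1
    push_cast
    ring
  have hp := Real.exp_pos (x / (2 * s))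
  rw [sechSqProfile, tanhProfile, hE, Real.cosh_eq, Real.exp_neg]
  field_simp
  ring

theorem abs_tanhProfile_le (s x : ℝ) : |tanhProfile s x| ≤ 1 := by
  have hp := Real.exp_pos (x / s)
  have h2 : 2 / (1 + Real.exp (x / s)) ≤ 2 := by
    rw [div_le_iff₀ (by positivity)]
    linarith
  have h0 : 0 ≤ 2 / (1 + Real.exp (x / s)) := by positivity
  rw [tanhProfile, abs_le]
  constructor <;> linarith

theorem sechSqProfile_nonneg (s x : ℝ) : 0 ≤ sechSqProfile s x := by
  have := (sq_le_one_iff_abs_le_one _).2 (abs_tanhProfile_le s x)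
  rw [sechSqProfile]
  linarith

theorem sechSqProfile_le_one (s x : ℝ) : sechSqProfile s x ≤ 1 := by
  rw [sechSqProfile]
  linarith [sq_nonneg (tanhProfile s x)]

theorem hasDerivAt_tanhProfile {s : ℝ} (hs : 0 < s) (x : ℝ) :
    HasDerivAt (tanhProfile s) (sechSqProfile s x / (2 * s)) x := by
  have hp := Real.exp_pos (x / s)
  have h := ((((hasDerivAt_id x).div_const s).exp.const_add 1).fun_inv
    (by simp only [id]; positivity)).const_mul 2 |>.const_sub 1
  refine (h.congr_deriv ?_).congr_of_eventuallyEq (Eventually.of_forall fun y => ?_)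
  · simp only [sechSqProfile, tanhProfile, id]
    field_simp
    ring
  · simp [tanhProfile, div_eq_mul_inv]

theorem hasDerivAt_sechSqProfile {s : ℝ} (hs : 0 < s) (x : ℝ) :
    HasDerivAt (sechSqProfile s) (-(sechSqProfile s x * tanhProfile s x) / s) x := by
  refine (((hasDerivAt_tanhProfile hs x).fun_pow 2).const_sub 1).congr_deriv ?_
  field_simp
  push_cast
  ring

theorem hasDerivAt_deriv_sechSqProfile {s : ℝ} (hs : 0 < s) (x : ℝ) :
    HasDerivAt (fun y => -(sechSqProfile s y * tanhProfile s y) / s)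
      ((sechSqProfile s x - 3 / 2 * sechSqProfile s x ^ 2) / s ^ 2) x := by
  refine (((hasDerivAt_sechSqProfile hs x).mul
    (hasDerivAt_tanhProfile hs x)).neg.div_const s).congr_deriv ?_
  rw [sechSqProfile]
  field_simp
  ring

theorem continuous_tanhProfile {s : ℝ} (hs : 0 < s) : Continuous (tanhProfile s) :=
  continuous_iff_continuousAt.2 fun x => (hasDerivAt_tanhProfile hs x).continuousAt

theorem continuous_sechSqProfile {s : ℝ} (hs : 0 < s) : Continuous (sechSqProfile s) :=
  continuous_iff_continuousAt.2 fun x => (hasDerivAt_sechSqProfile hs x).continuousAt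

theorem integrable_sechSqProfile {s : ℝ} (hs : 0 < s) : Integrable (sechSqProfile s) := by
  have hc := continuous_sechSqProfile hs
  refine integrable_of_intervalIntegral_norm_bounded (l := atTop) (4 * s)
    (a := fun n : ℝ => -n) (b := fun n => n)
    (fun n => (hc.integrableOn_Icc).mono_set Set.Ioc_subset_Icc_self)
    tendsto_neg_atTop_atBot tendsto_id (Eventually.of_forall fun n => ?_)
  have hd : ∀ x, HasDerivAt (fun y => 2 * s * tanhProfile s y) ‖sechSqProfile s x‖ x := by
    intro x
    refine ((hasDerivAt_tanhProfile hs x).const_mul (2 * s)).congr_deriv ?_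
    rw [Real.norm_of_nonneg (sechSqProfile_nonneg s x)]
    field_simp
  rw [intervalIntegral.integral_eq_sub_of_hasDerivAt (fun x _ => hd x)
    (hc.norm.intervalIntegrable _ _)]
  have h1 := abs_le.1 (abs_tanhProfile_le s n)
  have h2 := abs_le.1 (abs_tanhProfile_le s (-n))
  nlinarith

theorem tendsto_tanhProfile_atTop {s : ℝ} (hs : 0 < s) :
    Tendsto (tanhProfile s) atTop (𝓝 1) := by
  have h : Tendsto (fun x : ℝ => 1 + Real.exp (x / s)) atTop atTop :=
    tendsto_atTop_add_const_left _ _ (Real.tendsto_exp_atTop.comp (tendsto_id.atTop_div_const hs))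
  have h' := (h.const_div_atTop 2).const_sub 1
  rw [sub_zero] at h'
  exact h'

theorem tendsto_tanhProfile_atBot {s : ℝ} (hs : 0 < s) :
    Tendsto (tanhProfile s) atBot (𝓝 (-1)) := by
  have h : Tendsto (fun x : ℝ => 1 + Real.exp (x / s)) atBot (𝓝 (1 + 0)) :=
    (Real.tendsto_exp_atBot.comp (tendsto_id.atBot_div_const hs)).const_add 1
  have h' := ((tendsto_const_nhds (x := (2 : ℝ))).div h (by norm_num)).const_sub 1
  norm_num at h'
  exact h'

theorem integral_sechSqProfile {s : ℝ} (hs : 0 < s) : ∫ x, sechSqProfile s x = 4 * s := by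
  have hd : ∀ x, HasDerivAt (fun y => 2 * s * tanhProfile s y) (sechSqProfile s x) x := by
    intro x
    refine ((hasDerivAt_tanhProfile hs x).const_mul (2 * s)).congr_deriv ?_
    field_simp
  rw [integral_of_hasDerivAt_of_tendsto hd (integrable_sechSqProfile hs)
    ((tendsto_tanhProfile_atBot hs).const_mul _) ((tendsto_tanhProfile_atTop hs).const_mul _)]
  ring

theorem integrable_sechSqProfile_pow {s : ℝ} (hs : 0 < s) (n : ℕ) :
    Integrable fun x => sechSqProfile s x ^ (n + 1) := by
  simp only [pow_succ]
  refine (integrable_sechSqProfile hs).bdd_mul (c := 1)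
    ((continuous_sechSqProfile hs).pow n).aestronglyMeasurable (Eventually.of_forall fun x => ?_)
  have h0 := sechSqProfile_nonneg s x
  rw [Real.norm_of_nonneg (by positivity)]
  exact pow_le_one₀ h0 (sechSqProfile_le_one s x)

theorem integral_sechSqProfile_pow_succ {s : ℝ} (hs : 0 < s) (n : ℕ) :
    ((n + 1 : ℝ) + 1 / 2) * ∫ x, sechSqProfile s x ^ (n + 2) =
      (n + 1) * ∫ x, sechSqProfile s x ^ (n + 1) := by
  have hd : ∀ x, HasDerivAt (fun y => s * (sechSqProfile s y ^ (n + 1) * tanhProfile s y))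
      (((n + 1 : ℝ) + 1 / 2) * sechSqProfile s x ^ (n + 2)
        - (n + 1) * sechSqProfile s x ^ (n + 1)) x := by
    intro x
    refine ((((hasDerivAt_sechSqProfile hs x).fun_pow (n + 1)).mul
      (hasDerivAt_tanhProfile hs x)).const_mul s).congr_deriv ?_
    have hT : tanhProfile s x ^ 2 = 1 - sechSqProfile s x := by rw [sechSqProfile]; ring
    simp only [Nat.add_sub_cancel]
    push_cast
    field_simp
    ring_nf
    rw [hT]
    ring
  have h1 := (integrable_sechSqProfile_pow hs (n + 1)).const_mul ((n + 1 : ℝ) + 1 / 2)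
  have h0 := (integrable_sechSqProfile_pow hs n).const_mul (n + 1 : ℝ)
  have hf : Integrable fun y => s * (sechSqProfile s y ^ (n + 1) * tanhProfile s y) :=
    ((integrable_sechSqProfile_pow hs n).mul_bdd (c := 1)
      (continuous_tanhProfile hs).aestronglyMeasurable
      (Eventually.of_forall fun x => abs_tanhProfile_le s x)).const_mul s
  have h := integral_eq_zero_of_hasDerivAt_of_integrable hd (h1.sub h0) hf
  rw [integral_sub h1 h0, integral_const_mul, integral_const_mul] at h
  linarith

theorem integral_sechSqProfile_sq {s : ℝ} (hs : 0 < s) :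
    ∫ x, sechSqProfile s x ^ 2 = 8 / 3 * s := by
  have h := integral_sechSqProfile_pow_succ hs 0
  simp only [zero_add, pow_one, integral_sechSqProfile hs] at h
  norm_num at h
  linarith

theorem integral_sechSqProfile_cube {s : ℝ} (hs : 0 < s) :
    ∫ x, sechSqProfile s x ^ 3 = 32 / 15 * s := by
  have h := integral_sechSqProfile_pow_succ hs 1
  norm_num [integral_sechSqProfile_sq hs] at h
  linarith

theorem integral_sechSqProfile_pow_four {s : ℝ} (hs : 0 < s) :
    ∫ x, sechSqProfile s x ^ 4 = 64 / 35 * s := by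
  have h := integral_sechSqProfile_pow_succ hs 2
  norm_num [integral_sechSqProfile_cube hs] at h
  linarith

theorem memLp_two_sechSqProfile {s : ℝ} (hs : 0 < s) : MemLp (sechSqProfile s) 2 :=
  (memLp_two_iff_integrable_sq (continuous_sechSqProfile hs).aestronglyMeasurable).2
    (integrable_sechSqProfile_pow hs 1)

theorem memLp_two_sechSqProfile_sq {s : ℝ} (hs : 0 < s) :
    MemLp (fun x => sechSqProfile s x ^ 2) 2 :=
  (memLp_two_iff_integrable_sq ((continuous_sechSqProfile hs).fun_pow 2).aestronglyMeasurable).2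
    (by simpa only [← pow_mul] using integrable_sechSqProfile_pow hs 3)

theorem memLp_two_deriv_sechSqProfile {s : ℝ} (hs : 0 < s) :
    MemLp (fun y => -(sechSqProfile s y * tanhProfile s y) / s) 2 := by
  have hS := continuous_sechSqProfile hs
  have hT := continuous_tanhProfile hs
  have h : MemLp (fun y => sechSqProfile s y * tanhProfile s y) 2 :=
    (memLp_two_sechSqProfile hs).of_le (hS.mul hT).aestronglyMeasurable
      (Eventually.of_forall fun x => by
        rw [norm_mul]
        exact mul_le_of_le_one_right (norm_nonneg _) (abs_tanhProfile_le s x))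
  convert h.const_mul (-s⁻¹) using 2
  ring

theorem memLp_two_deriv_deriv_sechSqProfile {s : ℝ} (hs : 0 < s) :
    MemLp (fun x => (sechSqProfile s x - 3 / 2 * sechSqProfile s x ^ 2) / s ^ 2) 2 := by
  convert ((memLp_two_sechSqProfile hs).sub
    ((memLp_two_sechSqProfile_sq hs).const_mul (3 / 2))).const_mul (s ^ 2)⁻¹ using 2
  simp only [Pi.sub_apply]
  ring

theorem integrable_fun_sub {f g : ℝ → ℝ} (hf : Integrable f) (hg : Integrable g) :
    Integrable fun x => f x - g x :=
  hf.sub hg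

section SecondDerivative

variable {u u' u'' v v' v'' : ℝ → ℝ}

theorem integral_mul_secondDeriv_eq_neg (hu : ∀ x, HasDerivAt u (u' x) x)
    (hv : ∀ x, HasDerivAt v' (v'' x) x) (hu2 : MemLp u 2) (hu'2 : MemLp u' 2)
    (hv'2 : MemLp v' 2) (hv''2 : MemLp v'' 2) :
    ∫ x, u x * v'' x = -∫ x, u' x * v' x :=
  integral_mul_deriv_eq_deriv_mul_of_integrable (fun x _ => hu x) (fun x _ => hv x)
    (hu2.integrable_mul hv''2) (hu'2.integrable_mul hv'2) (hu2.integrable_mul hv'2)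

theorem integral_mul_secondDeriv_comm (hu : ∀ x, HasDerivAt u (u' x) x)
    (hu' : ∀ x, HasDerivAt u' (u'' x) x) (hv : ∀ x, HasDerivAt v (v' x) x)
    (hv' : ∀ x, HasDerivAt v' (v'' x) x) (hu2 : MemLp u 2) (hu'2 : MemLp u' 2)
    (hu''2 : MemLp u'' 2) (hv2 : MemLp v 2) (hv'2 : MemLp v' 2) (hv''2 : MemLp v'' 2) :
    ∫ x, u x * v'' x = ∫ x, v x * u'' x := by
  rw [integral_mul_secondDeriv_eq_neg hu hv' hu2 hu'2 hv'2 hv''2,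
    integral_mul_secondDeriv_eq_neg hv hu' hv2 hv'2 hu'2 hu''2]
  simp only [mul_comm]

theorem integral_mul_secondDeriv_self_nonpos (hv : ∀ x, HasDerivAt v (v' x) x)
    (hv' : ∀ x, HasDerivAt v' (v'' x) x) (hv2 : MemLp v 2) (hv'2 : MemLp v' 2)
    (hv''2 : MemLp v'' 2) : ∫ x, v x * v'' x ≤ 0 := by
  rw [integral_mul_secondDeriv_eq_neg hv hv' hv2 hv'2 hv'2 hv''2]
  exact neg_nonpos.2 (integral_nonneg fun x => mul_self_nonneg _)

/-- A Schrödinger operator `-s² ∂² + 1 + V` with `V ≥ 0` is bounded below by the identity. -/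
theorem integral_sq_le_integral_mul_schrodinger {V r : ℝ → ℝ} {s : ℝ}
    (hv : ∀ x, HasDerivAt v (v' x) x) (hv' : ∀ x, HasDerivAt v' (v'' x) x)
    (hv2 : MemLp v 2) (hv'2 : MemLp v' 2) (hv''2 : MemLp v'' 2) (hr2 : MemLp r 2)
    (hV : ∀ x, 0 ≤ V x) (hr : ∀ x, -s ^ 2 * v'' x + v x + V x * v x = r x) :
    ∫ x, v x ^ 2 ≤ ∫ x, v x * r x := by
  have hvr : Integrable fun x => v x * r x := hv2.integrable_mul hr2
  have hvv : Integrable fun x => s ^ 2 * (v x * v'' x) := (hv2.integrable_mul hv''2).const_mul _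
  have h : ∫ x, v x ^ 2 ≤ ∫ x, (v x * r x + s ^ 2 * (v x * v'' x)) := by
    refine integral_mono hv2.integrable_sq (hvr.add hvv) fun x => ?_
    have := mul_nonneg (hV x) (sq_nonneg (v x))
    simp only [← hr x]
    nlinarith
  rw [integral_add hvr hvv, integral_const_mul] at h
  nlinarith [integral_mul_secondDeriv_self_nonpos hv hv' hv2 hv'2 hv''2, sq_nonneg s]

/-- The upper bound `⟨v, L v⟩ ≤ ‖L v‖²` for `L = -s² ∂² + 1 + V` with `V ≥ 0`. -/
theorem integral_mul_schrodinger_le_integral_sq {V r : ℝ → ℝ} {s : ℝ}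
    (hv : ∀ x, HasDerivAt v (v' x) x) (hv' : ∀ x, HasDerivAt v' (v'' x) x)
    (hv2 : MemLp v 2) (hv'2 : MemLp v' 2) (hv''2 : MemLp v'' 2) (hr2 : MemLp r 2)
    (hV : ∀ x, 0 ≤ V x) (hr : ∀ x, -s ^ 2 * v'' x + v x + V x * v x = r x) :
    ∫ x, v x * r x ≤ ∫ x, r x ^ 2 := by
  have hvr : Integrable fun x => v x * r x := hv2.integrable_mul hr2
  have h : ∫ x, 2 * (v x * r x) ≤ ∫ x, (v x ^ 2 + r x ^ 2) :=
    integral_mono (hvr.const_mul 2) (hv2.integrable_sq.add hr2.integrable_sq) fun x => by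
      simp only
      nlinarith [sq_nonneg (v x - r x)]
  rw [integral_add hv2.integrable_sq hr2.integrable_sq, integral_const_mul] at h
  linarith [integral_sq_le_integral_mul_schrodinger hv hv' hv2 hv'2 hv''2 hr2 hV hr]

end SecondDerivative

section Resolvent

variable {w w' w'' : ℝ → ℝ} {s m : ℝ}

theorem integral_mul_sechSqProfile_sq (hs : 0 < s) (hw : ∀ x, HasDerivAt w (w' x) x)
    (hw' : ∀ x, HasDerivAt w' (w'' x) x) (hw2 : MemLp w 2) (hw'2 : MemLp w' 2)
    (hw''2 : MemLp w'' 2)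
    (heq : ∀ x, -s ^ 2 * w'' x + w x + 3 / 2 * sechSqProfile s x * w x =
      m * sechSqProfile s x) :
    ∫ x, w x * sechSqProfile s x ^ 2 = 8 / 9 * m * s := by
  have hS2 := memLp_two_sechSqProfile hs
  have hcomm := integral_mul_secondDeriv_comm hw hw' (hasDerivAt_sechSqProfile hs)
    (hasDerivAt_deriv_sechSqProfile hs) hw2 hw'2 hw''2 hS2 (memLp_two_deriv_sechSqProfile hs)
    (memLp_two_deriv_deriv_sechSqProfile hs)
  have i1 : Integrable fun x => w x * ((sechSqProfile s x - 3 / 2 * sechSqProfile s x ^ 2) / s ^ 2) :=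
    hw2.integrable_mul (memLp_two_deriv_deriv_sechSqProfile hs)
  have i2 : Integrable fun x => sechSqProfile s x * w'' x := hS2.integrable_mul hw''2
  have i3 := integrable_sechSqProfile_pow hs 1
  have h : ∀ x, w x * sechSqProfile s x ^ 2 = m / 3 * sechSqProfile s x ^ (1 + 1) + (s ^ 2 / 3 *
      (sechSqProfile s x * w'' x) - s ^ 2 / 3 *
      (w x * ((sechSqProfile s x - 3 / 2 * sechSqProfile s x ^ 2) / s ^ 2))) := by
    intro x
    have e : s ^ 2 * ((sechSqProfile s x - 3 / 2 * sechSqProfile s x ^ 2) / s ^ 2) =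
        sechSqProfile s x - 3 / 2 * sechSqProfile s x ^ 2 := mul_div_cancel₀ _ (by positivity)
    linear_combination sechSqProfile s x / 3 * heq x + w x / 3 * e
  simp only [h]
  rw [integral_add (i3.const_mul _) (integrable_fun_sub (i2.const_mul _) (i1.const_mul _)),
    integral_sub (i2.const_mul _) (i1.const_mul _), integral_const_mul, integral_const_mul,
    integral_const_mul, hcomm, integral_sechSqProfile_sq hs]
  ring

/-- Two-sided variational bounds for `⟨L⁻¹ (m S), m S⟩`, where `S = sech² (x / (2 s))` and
`L = -s² ∂² + 1 + (3/2) S`, obtained from the trial function `c S`. -/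
theorem variational_bounds (hs : 0 < s) (hw : ∀ x, HasDerivAt w (w' x) x)
    (hw' : ∀ x, HasDerivAt w' (w'' x) x) (hw2 : MemLp w 2) (hw'2 : MemLp w' 2)
    (hw''2 : MemLp w'' 2)
    (heq : ∀ x, -s ^ 2 * w'' x + w x + 3 / 2 * sechSqProfile s x * w x =
      m * sechSqProfile s x) (c : ℝ) :
    0 ≤ m * (∫ x, w x * sechSqProfile s x) - 16 / 3 * c * m * s + 32 / 5 * c ^ 2 * s ∧
    m * (∫ x, w x * sechSqProfile s x) - 16 / 3 * c * m * s + 32 / 5 * c ^ 2 * s ≤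
      8 / 3 * m ^ 2 * s - 64 / 5 * m * c * s + 576 / 35 * c ^ 2 * s := by
  have hS2 := memLp_two_sechSqProfile hs
  have hSS := memLp_two_sechSqProfile_sq hs
  have hv : ∀ x, HasDerivAt (fun y => w y - c * sechSqProfile s y) _ x := fun x =>
    (hw x).sub ((hasDerivAt_sechSqProfile hs x).const_mul c)
  have hv' : ∀ x, HasDerivAt (fun y => w' y - c * (-(sechSqProfile s y * tanhProfile s y) / s)) _ x :=
    fun x => (hw' x).sub ((hasDerivAt_deriv_sechSqProfile hs x).const_mul c)
  have hv2 := hw2.sub (hS2.const_mul c)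
  have hv'2 := hw'2.sub ((memLp_two_deriv_sechSqProfile hs).const_mul c)
  have hv''2 := hw''2.sub ((memLp_two_deriv_deriv_sechSqProfile hs).const_mul c)
  have hr2 := (hS2.const_mul m).sub (hSS.const_mul (3 * c))
  have hV : ∀ x, 0 ≤ 3 / 2 * sechSqProfile s x := fun x =>
    mul_nonneg (by norm_num) (sechSqProfile_nonneg s x)
  have hr : ∀ x, -s ^ 2 * (w'' x - c * ((sechSqProfile s x - 3 / 2 * sechSqProfile s x ^ 2) / s ^ 2))
      + (w x - c * sechSqProfile s x)
      + 3 / 2 * sechSqProfile s x * (w x - c * sechSqProfile s x)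
      = m * sechSqProfile s x - 3 * c * sechSqProfile s x ^ 2 := by
    intro x
    rw [← heq x]
    field_simp
    ring
  have h1 := integral_sq_le_integral_mul_schrodinger hv hv' hv2 hv'2 hv''2 hr2 hV hr
  have h2 := integral_mul_schrodinger_le_integral_sq hv hv' hv2 hv'2 hv''2 hr2 hV hr
  have h0 : 0 ≤ ∫ x, (w x - c * sechSqProfile s x) ^ 2 := integral_nonneg fun x => sq_nonneg _
  have p1 := integrable_sechSqProfile_pow hs 1
  have p2 := integrable_sechSqProfile_pow hs 2
  have p3 := integrable_sechSqProfile_pow hs 3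
  have q1 : Integrable fun x => w x * sechSqProfile s x := hw2.integrable_mul hS2
  have q2 : Integrable fun x => w x * sechSqProfile s x ^ 2 := hw2.integrable_mul hSS
  have hvr : ∫ x, (w x - c * sechSqProfile s x) *
      (m * sechSqProfile s x - 3 * c * sechSqProfile s x ^ 2) =
      m * (∫ x, w x * sechSqProfile s x) - 16 / 3 * c * m * s + 32 / 5 * c ^ 2 * s := by
    have : ∀ x, (w x - c * sechSqProfile s x) *
        (m * sechSqProfile s x - 3 * c * sechSqProfile s x ^ 2) =
        (m * (w x * sechSqProfile s x) - 3 * c * (w x * sechSqProfile s x ^ 2)) +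
        (3 * c ^ 2 * sechSqProfile s x ^ (2 + 1) - c * m * sechSqProfile s x ^ (1 + 1)) := by
      intro x
      ring
    simp only [this]
    rw [integral_add (integrable_fun_sub (q1.const_mul _) (q2.const_mul _))
      (integrable_fun_sub (p2.const_mul _) (p1.const_mul _)), integral_sub (q1.const_mul _) (q2.const_mul _),
      integral_sub (p2.const_mul _) (p1.const_mul _), integral_const_mul, integral_const_mul,
      integral_const_mul, integral_const_mul,
      integral_mul_sechSqProfile_sq hs hw hw' hw2 hw'2 hw''2 heq,
      integral_sechSqProfile_sq hs, integral_sechSqProfile_cube hs]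
    ring
  have hrr : ∫ x, (m * sechSqProfile s x - 3 * c * sechSqProfile s x ^ 2) ^ 2 =
      8 / 3 * m ^ 2 * s - 64 / 5 * m * c * s + 576 / 35 * c ^ 2 * s := by
    have : ∀ x, (m * sechSqProfile s x - 3 * c * sechSqProfile s x ^ 2) ^ 2 =
        (m ^ 2 * sechSqProfile s x ^ (1 + 1) - 6 * m * c * sechSqProfile s x ^ (2 + 1)) +
        9 * c ^ 2 * sechSqProfile s x ^ (3 + 1) := by
      intro x
      ring
    simp only [this]
    rw [integral_add (integrable_fun_sub (p1.const_mul _) (p2.const_mul _)) (p3.const_mul _),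
      integral_sub (p1.const_mul _) (p2.const_mul _), integral_const_mul, integral_const_mul,
      integral_const_mul, integral_sechSqProfile_sq hs, integral_sechSqProfile_cube hs,
      integral_sechSqProfile_pow_four hs]
    ring
  rw [← hvr, ← hrr]
  exact ⟨h0.trans h1, h2⟩

end Resolvent

theorem stmt_16 (a b z : ℝ) (ha : a < 0) (hb : 0 < b) (hz : z = b / (-a))
    (φ h : ℝ → ℝ)
    (hφ : φ = fun x => -(3/2) * (1 / Real.cosh (x / (2 * Real.sqrt (-a))))^2)
    (hh : ContDiff ℝ 2 h)
    (hh2 : Integrable (fun x => (h x)^2))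
    (hh'2 : Integrable (fun x => (deriv h x)^2))
    (hh''2 : Integrable (fun x => (deriv (deriv h) x)^2))
    (heq : ∀ x : ℝ, a * deriv (deriv h) x + h x - φ x * h x
        = φ x - b * deriv (deriv φ) x) :
    Real.sqrt (-a) * (4*z^2 + 46*z + 112) / 45
        ≤ (∫ x : ℝ, h x * (φ x - b * deriv (deriv φ) x)) ∧
    (∫ x : ℝ, h x * (φ x - b * deriv (deriv φ) x))
        ≤ Real.sqrt (-a) * ((22/45)*z^2 + (2/9)*z + 26/9) ∧
    (b ≠ -a → Real.sqrt (-a) * (4*z^2 + 46*z + 112) / 45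
        < (∫ x : ℝ, h x * (φ x - b * deriv (deriv φ) x))) := by
  have hs : 0 < Real.sqrt (-a) := Real.sqrt_pos.2 (by linarith)
  have hsa : a = -Real.sqrt (-a) ^ 2 := by rw [Real.sq_sqrt (by linarith)]; ring
  generalize Real.sqrt (-a) = s at hs hsa hφ ⊢
  have hbz : b = z * s ^ 2 := by
    rw [hz, hsa]
    field_simp
  simp only [one_div_cosh_sq_eq_sechSqProfile] at hφ
  have hφ' : deriv φ = fun y => -(3 / 2) * (-(sechSqProfile s y * tanhProfile s y) / s) := by
    rw [hφ]
    exact funext fun x => ((hasDerivAt_sechSqProfile hs x).const_mul _).deriv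
  have hf : ∀ x, φ x - b * deriv (deriv φ) x =
      -(3 / 2) * ((1 - z) * sechSqProfile s x + 3 / 2 * z * sechSqProfile s x ^ 2) := by
    intro x
    rw [hφ', ((hasDerivAt_deriv_sechSqProfile hs x).const_mul _).deriv, hφ, hbz]
    field_simp
    ring
  have hd1 : ContDiff ℝ 1 (deriv h) := ((contDiff_succ_iff_deriv (n := 1)).1 hh).2.2
  have hd0 : Continuous (deriv (deriv h)) := hd1.continuous_deriv le_rfl
  have hh1 : ∀ x, HasDerivAt h (deriv h x) x := fun x =>
    (hh.differentiable (by norm_num) x).hasDerivAt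
  have hh1' : ∀ x, HasDerivAt (deriv h) (deriv (deriv h) x) x := fun x =>
    (hd1.differentiable (by norm_num) x).hasDerivAt
  have l0 := (memLp_two_iff_integrable_sq hh.continuous.aestronglyMeasurable).2 hh2
  have l1 := (memLp_two_iff_integrable_sq hd1.continuous.aestronglyMeasurable).2 hh'2
  have l2 := (memLp_two_iff_integrable_sq hd0.aestronglyMeasurable).2 hh''2
  have hS2 := memLp_two_sechSqProfile hs
  have hSS := memLp_two_sechSqProfile_sq hs
  have hw : ∀ x, HasDerivAt (fun y => h y + 3 / 4 * z * sechSqProfile s y) _ x := fun x =>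
    (hh1 x).add ((hasDerivAt_sechSqProfile hs x).const_mul (3 / 4 * z))
  have hw' : ∀ x, HasDerivAt (fun y => deriv h y +
      3 / 4 * z * (-(sechSqProfile s y * tanhProfile s y) / s)) _ x :=
    fun x => (hh1' x).add ((hasDerivAt_deriv_sechSqProfile hs x).const_mul (3 / 4 * z))
  have hw2 := l0.add (hS2.const_mul (3 / 4 * z))
  have hw'2 := l1.add ((memLp_two_deriv_sechSqProfile hs).const_mul (3 / 4 * z))
  have hw''2 := l2.add ((memLp_two_deriv_deriv_sechSqProfile hs).const_mul (3 / 4 * z))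
  have hweq : ∀ x, -s ^ 2 * (deriv (deriv h) x + 3 / 4 * z *
        ((sechSqProfile s x - 3 / 2 * sechSqProfile s x ^ 2) / s ^ 2))
      + (h x + 3 / 4 * z * sechSqProfile s x)
      + 3 / 2 * sechSqProfile s x * (h x + 3 / 4 * z * sechSqProfile s x)
      = -(3 / 2) * (1 - z) * sechSqProfile s x := by
    intro x
    have := heq x
    rw [hf x, hφ, hsa] at this
    simp only at this
    have e : s ^ 2 * ((sechSqProfile s x - 3 / 2 * sechSqProfile s x ^ 2) / s ^ 2) =
        sechSqProfile s x - 3 / 2 * sechSqProfile s x ^ 2 := mul_div_cancel₀ _ (by positivity)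
    linear_combination this - 3 / 4 * z * e
  have hB := variational_bounds hs hw hw' hw2 hw'2 hw''2 hweq
  have hI2 := integral_mul_sechSqProfile_sq hs hw hw' hw2 hw'2 hw''2 hweq
  have q1 : Integrable fun x => (h x + 3 / 4 * z * sechSqProfile s x) * sechSqProfile s x :=
    hw2.integrable_mul hS2
  have q2 : Integrable fun x => (h x + 3 / 4 * z * sechSqProfile s x) * sechSqProfile s x ^ 2 :=
    hw2.integrable_mul hSS
  have p1 := integrable_sechSqProfile_pow hs 1
  have p2 := integrable_sechSqProfile_pow hs 2
  have hI : ∫ x, h x * (φ x - b * deriv (deriv φ) x) = -(3 / 2) * (1 - z) *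
      (∫ x, (h x + 3 / 4 * z * sechSqProfile s x) * sechSqProfile s x) +
      6 * z * (1 - z) * s + 18 / 5 * z ^ 2 * s := by
    have : ∀ x, h x * (φ x - b * deriv (deriv φ) x) =
        (-(3 / 2) * (1 - z) * ((h x + 3 / 4 * z * sechSqProfile s x) * sechSqProfile s x)
        - 9 / 4 * z * ((h x + 3 / 4 * z * sechSqProfile s x) * sechSqProfile s x ^ 2)) +
        (9 / 8 * z * (1 - z) * sechSqProfile s x ^ (1 + 1) +
        27 / 16 * z ^ 2 * sechSqProfile s x ^ (2 + 1)) := by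
      intro x
      rw [hf x]
      ring
    simp only [this]
    rw [integral_add (integrable_fun_sub (q1.const_mul _) (q2.const_mul _))
      ((p1.const_mul _).fun_add (p2.const_mul _)), integral_sub (q1.const_mul _) (q2.const_mul _),
      integral_add (p1.const_mul _) (p2.const_mul _), integral_const_mul, integral_const_mul,
      integral_const_mul, integral_const_mul, hI2, integral_sechSqProfile_sq hs,
      integral_sechSqProfile_cube hs]
    ring
  have hlo := (hB (5 / 12 * (-(3 / 2) * (1 - z)))).1
  have hup := (hB (3 / 8 * (-(3 / 2) * (1 - z)))).2
  have hpos : 0 ≤ s * (1 - z) ^ 2 := by positivity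
  rw [hI]
  refine ⟨by nlinarith, by nlinarith, fun hne => ?_⟩
  have hz1 : 1 - z ≠ 0 := by
    intro h1
    apply hne
    rw [hbz, hsa, ← sub_eq_zero.1 h1]
    ring
  have hpos' : 0 < s * (1 - z) ^ 2 := by positivity
  nlinarith
end

section
/- Let b > 0, a = c = −b, η₀ ∈ (−9/4, 0), ε ∈ {−1, 1}, w := ε(3+2η₀)/√(3(3+η₀)), φ(x) := η₀·sech²(x/(2√b)), ψ(x) := ε·√(3/(3+η₀))·η₀·sech²(x/(2√b)). Then there do not exist λ ∈ ℂ with Re λ > 0 and functions v, z : ℝ → ℂ, not both identically zero, each infinitely differentiable with every derivative (including order zero) square-integrable on ℝ, such that for all x ∈ ℝ: −d/dx[ b·w·v''(x) + (ψ(x) − w)·v(x) + z(x) + a·z''(x) + φ(x)·z(x) ] = λ·(v(x) − b·v''(x)) and −d/dx[ v(x) + c·v''(x) + b·w·z''(x) + (ψ(x) − w)·z(x) ] = λ·(z(x) − b·z''(x)). -/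
open MeasureTheory

section

open Filter Topology Set

/-- Square-integrability of a real function on the line. -/
@[fun_prop]
def SqInt (f : ℝ → ℝ) : Prop := MemLp f 2 volume

namespace SqInt

@[fun_prop]
theorem add {f g : ℝ → ℝ} (hf : SqInt f) (hg : SqInt g) : SqInt (fun x => f x + g x) :=
  MemLp.add hf hg

@[fun_prop]
theorem sub {f g : ℝ → ℝ} (hf : SqInt f) (hg : SqInt g) : SqInt (fun x => f x - g x) :=
  MemLp.sub hf hg

@[fun_prop]
theorem const_mul {f : ℝ → ℝ} (hf : SqInt f) (c : ℝ) : SqInt (fun x => c * f x) :=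
  MemLp.const_mul hf c

@[fun_prop]
theorem integrable_mul {f g : ℝ → ℝ} (hf : SqInt f) (hg : SqInt g) :
    Integrable (fun x => f x * g x) :=
  MemLp.integrable_mul hf hg

theorem bounded_mul {s f : ℝ → ℝ} (hs : Continuous s) (hs1 : ∀ x, |s x| ≤ 1) (hf : SqInt f) :
    SqInt (fun x => s x * f x) := by
  refine MemLp.of_le (g := f) hf (hs.aestronglyMeasurable.mul hf.1) (ae_of_all _ fun x => ?_)
  rw [norm_mul]
  exact mul_le_of_le_one_left (norm_nonneg _) (hs1 x)

end SqInt

theorem integral_eq_zero_of_total_deriv {F F' : ℝ → ℝ} (h : ∀ x, HasDerivAt F (F' x) x)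
    (hF' : Integrable F') (hF : Integrable F) : ∫ x, F' x = 0 :=
  integral_eq_zero_of_hasDerivAt_of_integrable h hF' hF

theorem sqInt_eq_zero {f : ℝ → ℝ} (hf : Continuous f) (h2 : SqInt f)
    (h : ∫ x, f x * f x ≤ 0) (x : ℝ) : f x = 0 := by
  have h0 : ∫ x, f x * f x = 0 :=
    le_antisymm h (integral_nonneg fun x => mul_self_nonneg _)
  rw [integral_eq_zero_iff_of_nonneg (fun x => mul_self_nonneg _) (h2.integrable_mul h2)] at h0
  have := (Continuous.ae_eq_iff_eq volume (hf.mul hf) continuous_zero).1 h0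
  exact mul_self_eq_zero.1 (congrFun this x)

theorem hasDerivAt_tanh_mul (k x : ℝ) :
    HasDerivAt (fun y => Real.tanh (k * y)) (k * (1 - Real.tanh (k * x) ^ 2)) x := by
  have hc := (Real.cosh_pos (k * x)).ne'
  have hk : HasDerivAt (fun y : ℝ => k * y) k x := by simpa using (hasDerivAt_id x).const_mul k
  have h := (hk.sinh).div hk.cosh hc
  have he : (fun y => Real.tanh (k * y)) =
      (fun y => Real.sinh (k * y)) / fun y => Real.cosh (k * y) := by
    ext y; exact Real.tanh_eq_sinh_div_cosh _
  rw [he]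
  convert! h using 1
  rw [Real.tanh_eq_sinh_div_cosh]
  field_simp

/-- The squared hyperbolic secant `sech² (k x)`. -/
noncomputable def sechSq (k x : ℝ) : ℝ := 1 - Real.tanh (k * x) ^ 2

theorem sechSq_eq (k x : ℝ) : sechSq k x = (1 / Real.cosh (k * x)) ^ 2 := by
  have hc := (Real.cosh_pos (k * x)).ne'
  rw [sechSq, Real.tanh_eq_sinh_div_cosh]
  field_simp
  linarith [Real.cosh_sq (k * x)]

theorem hasDerivAt_sechSq (k x : ℝ) :
    HasDerivAt (sechSq k) (-2 * k * (Real.tanh (k * x) * sechSq k x)) x := by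
  have h := ((hasDerivAt_tanh_mul k x).pow 2).const_sub 1
  convert! h using 1
  simp [sechSq]; ring

theorem continuous_tanh_mul (k : ℝ) : Continuous fun x => Real.tanh (k * x) :=
  continuous_iff_continuousAt.2 fun x => (hasDerivAt_tanh_mul k x).continuousAt

@[fun_prop]
theorem continuous_sechSq (k : ℝ) : Continuous (sechSq k) :=
  continuous_iff_continuousAt.2 fun x => (hasDerivAt_sechSq k x).continuousAt

theorem sechSq_pos (k x : ℝ) : 0 < sechSq k x := by
  have := Real.tanh_sq_lt_one (k * x); unfold sechSq; linarith

theorem sechSq_le_one (k x : ℝ) : sechSq k x ≤ 1 := by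
  unfold sechSq; nlinarith [sq_nonneg (Real.tanh (k * x))]

theorem abs_sechSq_le_one (k x : ℝ) : |sechSq k x| ≤ 1 := by
  rw [abs_of_pos (sechSq_pos k x)]; exact sechSq_le_one k x

theorem sqInt_sechSq {k : ℝ} (hk : k ≠ 0) : SqInt (sechSq k) := by
  refine (memLp_two_iff_integrable_sq (continuous_sechSq k).aestronglyMeasurable).2 ?_
  refine ((integrable_inv_one_add_sq.comp_mul_left' hk)).mono'
    ((continuous_sechSq k).pow 2).aestronglyMeasurable (ae_of_all _ fun x => ?_)
  have h1 := sechSq_pos k x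
  have h2 := sechSq_le_one k x
  have h3 : sechSq k x ≤ (1 + (k * x) ^ 2)⁻¹ := by
    rw [sechSq_eq, div_pow, one_pow, one_div]
    apply inv_anti₀ (by positivity)
    rw [Real.cosh_sq]
    have : (k * x) ^ 2 ≤ Real.sinh (k * x) ^ 2 := by
      rw [sq_le_sq, Real.abs_sinh]
      exact Real.self_le_sinh_iff.2 (abs_nonneg _)
    linarith
  rw [Real.norm_eq_abs, abs_of_nonneg (by positivity)]
  nlinarith

@[fun_prop]
theorem SqInt.sechSq_mul {f : ℝ → ℝ} (k : ℝ) (hf : SqInt f) :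
    SqInt (fun x => sechSq k x * f x) :=
  hf.bounded_mul (continuous_sechSq k) (abs_sechSq_le_one k)

@[fun_prop]
theorem SqInt.tanh_mul {f : ℝ → ℝ} (k : ℝ) (hf : SqInt f) :
    SqInt (fun x => Real.tanh (k * x) * f x) :=
  hf.bounded_mul (continuous_tanh_mul k) fun _ => (Real.abs_tanh_lt_one _).le

theorem tendsto_sq_zero {f f' : ℝ → ℝ} (h : ∀ x, HasDerivAt f (f' x) x) (hf : SqInt f)
    (hf' : SqInt f') :
    Tendsto (fun x => f x ^ 2) atTop (𝓝 0) ∧ Tendsto (fun x => f x ^ 2) atBot (𝓝 0) := by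
  have hd : ∀ x, HasDerivAt (fun x => f x ^ 2) (2 * (f x * f' x)) x := fun x => by
    convert! (h x).pow 2 using 1; simp; ring
  have hi : Integrable fun x => 2 * (f x * f' x) := by fun_prop
  have hi2 : Integrable fun x => f x ^ 2 := by simp_rw [pow_two]; fun_prop
  exact ⟨tendsto_zero_of_hasDerivAt_of_integrableOn_Ioi (a := 0) (fun x _ => hd x)
      hi.integrableOn hi2.integrableOn,
    tendsto_zero_of_hasDerivAt_of_integrableOn_Iic (a := 0) (fun x _ => hd x)
      hi.integrableOn hi2.integrableOn⟩

/-- The flux `b h r²`, where `h` is the logarithmic derivative of `(sech²)'` and `4 k² b = 1`. -/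
noncomputable def flux (k b : ℝ) (r : ℝ → ℝ) (x : ℝ) : ℝ :=
  b * k * (1 - 3 * Real.tanh (k * x) ^ 2) * (r x / Real.tanh (k * x) * r x)

theorem tanh_mul_ne_zero {k x : ℝ} (hk : k ≠ 0) (hx : x ≠ 0) : Real.tanh (k * x) ≠ 0 := by
  rw [Real.tanh_eq_sinh_div_cosh]
  exact div_ne_zero (fun h => mul_ne_zero hk hx (Real.sinh_eq_zero.1 h)) (Real.cosh_pos _).ne'

theorem hasDerivAt_flux {k b : ℝ} (hk : k ≠ 0) (hb : 4 * k ^ 2 * b = 1) {r r' : ℝ → ℝ}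
    {x : ℝ} (hr : HasDerivAt r (r' x) x) (hx : x ≠ 0) :
    HasDerivAt (flux k b r) (b * (r' x * r' x) + r x * r x - 3 * (sechSq k x * r x * r x)
      - b * (r' x - k * (1 - 3 * Real.tanh (k * x) ^ 2) / Real.tanh (k * x) * r x) ^ 2) x := by
  have hT := tanh_mul_ne_zero hk hx
  have h := ((((hasDerivAt_tanh_mul k x).pow 2).const_mul 3).const_sub 1 |>.const_mul (b * k)).mul
    ((hr.div (hasDerivAt_tanh_mul k x) hT).mul hr)
  convert! h using 1
  simp only [sechSq, Pi.div_apply, Pi.mul_apply, Pi.pow_apply]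
  have hb' : b = 1 / (4 * k ^ 2) := by field_simp; linarith
  subst hb'
  field_simp
  ring

theorem continuous_flux {k b : ℝ} (hk : k ≠ 0) (hb : 4 * k ^ 2 * b = 1) {r r' : ℝ → ℝ}
    (hr : ∀ x, HasDerivAt r (r' x) x) (h0 : r 0 = 0) : Continuous (flux k b r) := by
  refine continuous_iff_continuousAt.2 fun x => ?_
  rcases eq_or_ne x 0 with rfl | hx
  · rw [continuousAt_iff_punctured_nhds]
    have h1 := (hr 0).tendsto_slope
    have h2 := (hasDerivAt_tanh_mul k 0).tendsto_slope
    have h3 : Tendsto r (𝓝[≠] 0) (𝓝 0) := by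
      have := (hr 0).continuousAt.tendsto
      rw [h0] at this
      exact this.mono_left nhdsWithin_le_nhds
    have h4 : Tendsto (fun x => b * k * (1 - 3 * Real.tanh (k * x) ^ 2)) (𝓝[≠] 0)
        (𝓝 (b * k * (1 - 3 * Real.tanh (k * 0) ^ 2))) := by
      have : Continuous fun x => b * k * (1 - 3 * Real.tanh (k * x) ^ 2) := by
        have := continuous_tanh_mul k
        fun_prop
      exact this.continuousAt.tendsto.mono_left nhdsWithin_le_nhds
    have h5 := h4.mul ((h1.div h2 (by simpa using hk)).mul h3)
    have e : flux k b r 0 = b * k * (1 - 3 * Real.tanh (k * 0) ^ 2) *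
        (r' 0 / (k * (1 - Real.tanh (k * 0) ^ 2)) * 0) := by simp [flux]
    rw [e]
    refine h5.congr' ?_
    filter_upwards [self_mem_nhdsWithin] with y hy
    have hy' : y ≠ 0 := hy
    have := tanh_mul_ne_zero hk hy'
    simp only [flux, slope_def_field, h0, mul_zero, Real.tanh_zero, sub_zero, Pi.div_apply]
    field_simp
  · exact (hasDerivAt_flux hk hb (hr x) hx).continuousAt

theorem tendsto_flux {k b : ℝ} (hk : 0 < k) {r r' : ℝ → ℝ}
    (hr : ∀ x, HasDerivAt r (r' x) x) (h2 : SqInt r) (h2' : SqInt r') :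
    Tendsto (flux k b r) atTop (𝓝 0) ∧ Tendsto (flux k b r) atBot (𝓝 0) := by
  obtain ⟨hp, hm⟩ := tendsto_sq_zero hr h2 h2'
  have ht : 0 < Real.tanh k := by
    rw [Real.tanh_eq_sinh_div_cosh]; exact div_pos (Real.sinh_pos_iff.2 hk) (Real.cosh_pos _)
  have hmono : Monotone fun x => Real.tanh (k * x) :=
    monotone_of_deriv_nonneg (fun x => (hasDerivAt_tanh_mul k x).differentiableAt) fun x => by
      rw [(hasDerivAt_tanh_mul k x).deriv]
      exact mul_nonneg hk.le (sechSq_pos k x).le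
  have key : ∀ x, 1 ≤ |x| → ‖flux k b r x‖ ≤ |b * k| * 4 / Real.tanh k * r x ^ 2 := by
    intro x hx
    have h1 : Real.tanh k ≤ |Real.tanh (k * x)| := by
      rcases le_abs.1 hx with h | h
      · have := hmono h
        simp only [mul_one] at this
        exact this.trans (le_abs_self _)
      · have := hmono h
        simp only [mul_one, mul_neg, Real.tanh_neg] at this
        exact this.trans (neg_le_abs _)
    have h3 : |1 - 3 * Real.tanh (k * x) ^ 2| ≤ 4 := by
      have := Real.tanh_sq_lt_one (k * x)
      rw [abs_le]; constructor <;> nlinarith [sq_nonneg (Real.tanh (k * x))]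
    have e : flux k b r x = b * k * (1 - 3 * Real.tanh (k * x) ^ 2) / Real.tanh (k * x)
        * r x ^ 2 := by unfold flux; ring
    rw [e, Real.norm_eq_abs, abs_mul, abs_div, abs_mul, abs_of_nonneg (sq_nonneg (r x))]
    gcongr
  constructor
  · refine squeeze_zero_norm' ?_
      (by simpa only [mul_zero] using hp.const_mul (|b * k| * 4 / Real.tanh k))
    filter_upwards [eventually_ge_atTop 1] with x hx
    exact key x (hx.trans (le_abs_self _))
  · refine squeeze_zero_norm' ?_
      (by simpa only [mul_zero] using hm.const_mul (|b * k| * 4 / Real.tanh k))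
    filter_upwards [eventually_le_atBot (-1)] with x hx
    exact key x (by linarith [neg_le_abs x])

/-- The Schrödinger form of `1 - b ∂² - 3 sech²` is nonnegative on functions vanishing at the
zero of its kernel element. -/
theorem form_nonneg_of_zero {k b : ℝ} (hk : 0 < k) (hb : 4 * k ^ 2 * b = 1) {r r' : ℝ → ℝ}
    (hr : ∀ x, HasDerivAt r (r' x) x) (hc : Continuous r') (h2 : SqInt r) (h2' : SqInt r')
    (h0 : r 0 = 0) :
    0 ≤ ∫ x, (b * (r' x * r' x) + r x * r x - 3 * (sechSq k x * r x * r x)) := by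
  set E : ℝ → ℝ := fun x => b * (r' x * r' x) + r x * r x - 3 * (sechSq k x * r x * r x) with hE
  have hb0 : 0 ≤ b := by nlinarith [sq_nonneg k]
  have hrc : Continuous r := continuous_iff_continuousAt.2 fun x => (hr x).continuousAt
  have hEc : Continuous E := by fun_prop
  have hEi : Integrable E := by fun_prop
  set F : ℝ → ℝ := fun x => (∫ y in (0 : ℝ)..x, E y) - flux k b r x with hF
  have hd : ∀ x, HasDerivAt (fun x => ∫ y in (0 : ℝ)..x, E y) (E x) x := fun x =>
    intervalIntegral.integral_hasDerivAt_right (hEc.intervalIntegrable _ _)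
      hEc.stronglyMeasurable.stronglyMeasurableAtFilter hEc.continuousAt
  have hFc : Continuous F :=
    (continuous_iff_continuousAt.2 fun x => (hd x).continuousAt).sub
      (continuous_flux hk.ne' hb hr h0)
  have hFd : ∀ x, x ≠ 0 → HasDerivAt F (b * (r' x - k * (1 - 3 * Real.tanh (k * x) ^ 2)
      / Real.tanh (k * x) * r x) ^ 2) x := fun x hx => by
    convert! (hd x).sub (hasDerivAt_flux hk.ne' hb (hr x) hx) using 1
    simp only [hE]; ring
  have hmono : Monotone F := by
    have h1 : MonotoneOn F (Iic 0) := by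
      refine monotoneOn_of_deriv_nonneg (convex_Iic 0) hFc.continuousOn ?_ ?_
      · intro x hx
        rw [interior_Iic] at hx
        exact (hFd x (ne_of_lt hx)).differentiableAt.differentiableWithinAt
      · intro x hx
        rw [interior_Iic] at hx
        rw [(hFd x (ne_of_lt hx)).deriv]; positivity
    have h2 : MonotoneOn F (Ici 0) := by
      refine monotoneOn_of_deriv_nonneg (convex_Ici 0) hFc.continuousOn ?_ ?_
      · intro x hx
        rw [interior_Ici] at hx
        exact (hFd x (ne_of_gt hx)).differentiableAt.differentiableWithinAt
      · intro x hx
        rw [interior_Ici] at hx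
        rw [(hFd x (ne_of_gt hx)).deriv]; positivity
    have := h1.union_right h2 isGreatest_Iic isLeast_Ici
    rwa [Iic_union_Ici, monotoneOn_univ] at this
  obtain ⟨tp, tm⟩ := tendsto_flux (b := b) hk hr h2 h2'
  have hlim : Tendsto (fun R : ℝ => (∫ y in (-R)..R, E y) - (flux k b r R - flux k b r (-R)))
      atTop (𝓝 ((∫ x, E x) - (0 - 0))) :=
    (intervalIntegral_tendsto_integral hEi tendsto_neg_atTop_atBot tendsto_id).sub
      (tp.sub (tm.comp tendsto_neg_atTop_atBot))
  have : 0 ≤ (∫ x, E x) - (0 - 0) := by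
    refine ge_of_tendsto hlim ?_
    filter_upwards [eventually_ge_atTop 0] with R hR
    have h := hmono (show -R ≤ R by linarith)
    have hs : (∫ y in (-R)..R, E y) = (∫ y in (0 : ℝ)..R, E y) - ∫ y in (0 : ℝ)..(-R), E y :=
      (intervalIntegral.integral_interval_sub_left (hEc.intervalIntegrable _ _)
        (hEc.intervalIntegrable _ _)).symm
    simp only [hF] at h
    rw [hs]; linarith
  simpa using this

theorem sechSq_form_lower_bound {k b : ℝ} (hk : 0 < k) (hb : 4 * k ^ 2 * b = 1) {f f' : ℝ → ℝ}
    (hf : ∀ x, HasDerivAt f (f' x) x) (hc : Continuous f') (h2 : SqInt f) (h2' : SqInt f') :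
    3 / 2 * f 0 ^ 2 * (∫ x, sechSq k x * (sechSq k x * sechSq k x))
        - 3 * f 0 * (∫ x, sechSq k x * (sechSq k x * f x)) ≤
      ∫ x, (b * (f' x * f' x) + f x * f x - 3 * (sechSq k x * f x * f x)) := by
  have hs : SqInt (sechSq k) := sqInt_sechSq hk.ne'
  have hT := continuous_tanh_mul k
  have hr : ∀ x, HasDerivAt (fun y => f y - f 0 * sechSq k y)
      ((fun y => f' y - f 0 * (-2 * k * (Real.tanh (k * y) * sechSq k y))) x) x := fun x =>
    (hf x).sub ((hasDerivAt_sechSq k x).const_mul (f 0))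
  have hpos := form_nonneg_of_zero hk hb hr (by fun_prop) (by fun_prop) (by fun_prop)
    (by simp [sechSq])
  have hW : ∀ x, HasDerivAt
      (fun y => (2 * f 0 * b * (-2 * k)) * (Real.tanh (k * y) * sechSq k y * f y)
        - (f 0 ^ 2 * b * (-2 * k)) * (Real.tanh (k * y) * sechSq k y * sechSq k y))
      ((2 * f 0 * b * (-2 * k)) * ((k * (sechSq k x * sechSq k x)
          - 2 * k * (Real.tanh (k * x) * (Real.tanh (k * x) * sechSq k x))) * f x
          + Real.tanh (k * x) * sechSq k x * f' x)
        - (f 0 ^ 2 * b * (-2 * k)) * ((k * (sechSq k x * sechSq k x)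
          - 2 * k * (Real.tanh (k * x) * (Real.tanh (k * x) * sechSq k x))) * sechSq k x
          + Real.tanh (k * x) * sechSq k x * (-2 * k * (Real.tanh (k * x) * sechSq k x)))) x := by
    intro x
    have hTs := (hasDerivAt_tanh_mul k x).mul (hasDerivAt_sechSq k x)
    convert! ((hTs.mul (hf x)).const_mul _).sub
      ((hTs.mul (hasDerivAt_sechSq k x)).const_mul _) using 1
    simp only [sechSq, Pi.mul_apply]; ring
  have h0 := integral_eq_zero_of_total_deriv hW (by fun_prop) (by fun_prop)
  have key := congrArg₂ (· + ·) (Eq.refl (∫ x, (b *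
    ((f' x - f 0 * (-2 * k * (Real.tanh (k * x) * sechSq k x))) *
      (f' x - f 0 * (-2 * k * (Real.tanh (k * x) * sechSq k x)))) +
    (f x - f 0 * sechSq k x) * (f x - f 0 * sechSq k x) -
    3 * (sechSq k x * (f x - f 0 * sechSq k x) * (f x - f 0 * sechSq k x))))) h0
  rw [← integral_add (by fun_prop) (by fun_prop)] at key
  have e : (∫ x, (b * (f' x * f' x) + f x * f x - 3 * (sechSq k x * f x * f x)))
      - 3 / 2 * f 0 ^ 2 * (∫ x, sechSq k x * (sechSq k x * sechSq k x))
        + 3 * f 0 * (∫ x, sechSq k x * (sechSq k x * f x)) =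
      ∫ x, (b * (f' x * f' x) + f x * f x - 3 * (sechSq k x * f x * f x)
        - 3 / 2 * f 0 ^ 2 * (sechSq k x * (sechSq k x * sechSq k x))
        + 3 * f 0 * (sechSq k x * (sechSq k x * f x))) := by
    rw [← integral_const_mul, ← integral_const_mul, ← integral_sub (by fun_prop) (by fun_prop),
      ← integral_add (by fun_prop) (by fun_prop)]
  have e2 : (∫ x, (b * (f' x * f' x) + f x * f x - 3 * (sechSq k x * f x * f x)
        - 3 / 2 * f 0 ^ 2 * (sechSq k x * (sechSq k x * sechSq k x))
        + 3 * f 0 * (sechSq k x * (sechSq k x * f x)))) = _ :=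
    (integral_congr_ae (ae_of_all _ fun x => by
      have hb' : b = 1 / (4 * k ^ 2) := by field_simp; linarith
      simp only [hb', sechSq]
      field_simp
      ring)).trans key
  linarith

theorem form_lower_bound {k b α γ : ℝ} (hk : 0 < k) (hb : 4 * k ^ 2 * b = 1) (hα : 0 < α)
    (hγ : 0 < γ) {f f' g g' : ℝ → ℝ}
    (hf : ∀ x, HasDerivAt f (f' x) x) (hc : Continuous f') (h2 : SqInt f) (h2' : SqInt f')
    (g2 : SqInt g) (g2' : SqInt g')
    (horth : ∫ x, sechSq k x * (sechSq k x * (2 * f x + g x)) = 0) :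
    γ * ∫ x, g x * g x ≤
      α * (∫ x, (b * (f' x * f' x) + f x * f x - 3 * (sechSq k x * f x * f x)))
        + ∫ x, (γ * (b * (g' x * g' x) + g x * g x) + 3 * α * (sechSq k x * g x * g x)) := by
  have hs : SqInt (sechSq k) := sqInt_sechSq hk.ne'
  have hb0 : 0 ≤ b := by nlinarith [sq_nonneg k]
  have h1 := sechSq_form_lower_bound hk hb hf hc h2 h2'
  have ho : 2 * (∫ x, sechSq k x * (sechSq k x * f x))
      + ∫ x, sechSq k x * (sechSq k x * g x) = 0 := by
    rw [← horth, ← integral_const_mul, ← integral_add (by fun_prop) (by fun_prop)]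
    congr 1; ext x; ring
  have h3 : 0 ≤ ∫ x, (α * (3 / 2 * f 0 ^ 2 * (sechSq k x * (sechSq k x * sechSq k x))
      + 3 / 2 * f 0 * (sechSq k x * (sechSq k x * g x))) + 3 * α * (sechSq k x * g x * g x)
      + γ * b * (g' x * g' x)) := by
    refine integral_nonneg fun x => ?_
    have hsp := sechSq_pos k x
    have e : α * (3 / 2 * f 0 ^ 2 * (sechSq k x * (sechSq k x * sechSq k x))
      + 3 / 2 * f 0 * (sechSq k x * (sechSq k x * g x))) + 3 * α * (sechSq k x * g x * g x)
      + γ * b * (g' x * g' x) = α * sechSq k x * (3 / 4 * (f 0 * sechSq k x + g x) ^ 2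
        + 3 / 4 * (f 0 * sechSq k x) ^ 2 + 9 / 4 * g x ^ 2) + γ * b * g' x ^ 2 := by ring
    simp only [Pi.zero_apply]
    rw [e]
    positivity
  have h4 : (∫ x, (γ * (b * (g' x * g' x) + g x * g x) + 3 * α * (sechSq k x * g x * g x))) =
      γ * b * (∫ x, g' x * g' x) + γ * (∫ x, g x * g x)
        + 3 * α * ∫ x, sechSq k x * g x * g x := by
    rw [← integral_const_mul, ← integral_const_mul, ← integral_const_mul,
      ← integral_add (by fun_prop) (by fun_prop), ← integral_add (by fun_prop) (by fun_prop)]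
    congr 1; ext x; ring
  rw [integral_add (by fun_prop) (by fun_prop), integral_add (by fun_prop) (by fun_prop),
    integral_const_mul, integral_const_mul, integral_const_mul,
    integral_add (by fun_prop) (by fun_prop), integral_const_mul, integral_const_mul] at h3
  rw [h4]
  have h5 := mul_le_mul_of_nonneg_left h1 hα.le
  have h6 : (∫ x, sechSq k x * (sechSq k x * f x)) =
    -(1 / 2) * ∫ x, sechSq k x * (sechSq k x * g x) := by linarith
  rw [h6] at h5
  linarith

/-- `f` is twice differentiable with derivatives `f'`, `f''`, all square-integrable. -/
structure IsJet (f f' f'' : ℝ → ℝ) : Prop where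
  deriv_one : ∀ x, HasDerivAt f (f' x) x
  deriv_two : ∀ x, HasDerivAt f' (f'' x) x
  sqInt_zero : SqInt f
  sqInt_one : SqInt f'
  sqInt_two : SqInt f''

theorem IsJet.continuous_one {f f' f'' : ℝ → ℝ} (h : IsJet f f' f'') : Continuous f' :=
  continuous_iff_continuousAt.2 fun x => (h.deriv_two x).continuousAt

theorem IsJet.continuous_zero {f f' f'' : ℝ → ℝ} (h : IsJet f f' f'') : Continuous f :=
  continuous_iff_continuousAt.2 fun x => (h.deriv_one x).continuousAt

theorem IsJet.lin_comb {f f' f'' g g' g'' : ℝ → ℝ} (hf : IsJet f f' f'') (hg : IsJet g g' g'')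
    (p q : ℝ) : IsJet (fun x => p * f x + q * g x) (fun x => p * f' x + q * g' x)
      (fun x => p * f'' x + q * g'' x) := by
  obtain ⟨f1, f2, f3, f4, f5⟩ := hf
  obtain ⟨g1, g2, g3, g4, g5⟩ := hg
  exact ⟨fun x => ((f1 x).const_mul p).add ((g1 x).const_mul q),
    fun x => ((f2 x).const_mul p).add ((g2 x).const_mul q), by fun_prop, by fun_prop, by fun_prop⟩

theorem integral_selfAdjoint {k b α β : ℝ} {f f' f'' g g' g'' : ℝ → ℝ}
    (hf : IsJet f f' f'') (hg : IsJet g g' g'') :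
    ∫ x, (f x * (α * (g x - b * g'' x) + β * (sechSq k x * g x))
      - g x * (α * (f x - b * f'' x) + β * (sechSq k x * f x))) = 0 := by
  obtain ⟨f1, f2, f3, f4, f5⟩ := hf
  obtain ⟨g1, g2, g3, g4, g5⟩ := hg
  refine integral_eq_zero_of_total_deriv
    (F := fun x => α * b * (g x * f' x - f x * g' x)) (fun x => ?_) (by fun_prop) (by fun_prop)
  convert! (((g1 x).mul (f2 x)).sub ((f1 x).mul (g2 x))).const_mul (α * b) using 1
  ring

theorem integral_form_eq {k b α β : ℝ} {f f' f'' : ℝ → ℝ} (hf : IsJet f f' f'') :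
    ∫ x, f x * (α * (f x - b * f'' x) + β * (sechSq k x * f x)) =
      ∫ x, (α * (b * (f' x * f' x) + f x * f x) + β * (sechSq k x * f x * f x)) := by
  obtain ⟨f1, f2, f3, f4, f5⟩ := hf
  rw [← sub_eq_zero, ← integral_sub (by fun_prop) (by fun_prop)]
  refine integral_eq_zero_of_total_deriv
    (F := fun x => -(α * b) * (f x * f' x)) (fun x => ?_) (by fun_prop) (by fun_prop)
  convert! ((f1 x).mul (f2 x)).const_mul (-(α * b)) using 1
  ring

theorem integral_kernel_eq_zero {k b : ℝ} (hk : k ≠ 0) (hb : 4 * k ^ 2 * b = 1) (α : ℝ)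
    {f f' f'' : ℝ → ℝ} (hf : IsJet f f' f'') :
    ∫ x, Real.tanh (k * x) * sechSq k x *
      (α * (f x - b * f'' x) + -3 * α * (sechSq k x * f x)) = 0 := by
  have hs : SqInt (sechSq k) := sqInt_sechSq hk
  obtain ⟨f1, f2, f3, f4, f5⟩ := hf
  refine integral_eq_zero_of_total_deriv
    (F := fun x => α * b * ((k * (sechSq k x * sechSq k x)
      - 2 * k * (Real.tanh (k * x) * (Real.tanh (k * x) * sechSq k x))) * f x
        - Real.tanh (k * x) * sechSq k x * f' x)) (fun x => ?_) (by fun_prop) (by fun_prop)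
  have ht := hasDerivAt_tanh_mul k x
  have h1 := hasDerivAt_sechSq k x
  convert! ((((((h1.mul h1).const_mul k).sub ((ht.mul (ht.mul h1)).const_mul (2 * k))).mul
    (f1 x)).sub ((ht.mul h1).mul (f2 x))).const_mul (α * b)) using 1
  have hb' : b = 1 / (4 * k ^ 2) := by field_simp; linarith
  simp only [hb', sechSq, Pi.mul_apply, Pi.sub_apply]
  field_simp
  ring

theorem integral_kernel_antideriv {k b : ℝ} (hk : k ≠ 0) (hb : 4 * k ^ 2 * b = 1)
    {m u u' : ℝ → ℝ} (hm : ∀ x, HasDerivAt m (u x) x) (hu : ∀ x, HasDerivAt u (u' x) x)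
    (m2 : SqInt m) (u2 : SqInt u) (u2' : SqInt u') :
    ∫ x, Real.tanh (k * x) * sechSq k x * (m x - b * u' x) =
      3 / (4 * k) * ∫ x, sechSq k x * (sechSq k x * u x) := by
  have hs : SqInt (sechSq k) := sqInt_sechSq hk
  rw [← sub_eq_zero, ← integral_const_mul, ← integral_sub (by fun_prop) (by fun_prop)]
  refine integral_eq_zero_of_total_deriv
    (F := fun x => -1 / (2 * k) * (sechSq k x * m x)
      - b * (Real.tanh (k * x) * sechSq k x * u x)) (fun x => ?_) (by fun_prop) (by fun_prop)
  have ht := hasDerivAt_tanh_mul k x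
  have h1 := hasDerivAt_sechSq k x
  convert! ((h1.mul (hm x)).const_mul (-1 / (2 * k))).sub
    (((ht.mul h1).mul (hu x)).const_mul b) using 1
  have hb' : b = 1 / (4 * k ^ 2) := by field_simp; linarith
  simp only [hb', sechSq, Pi.mul_apply]
  field_simp
  ring

theorem integral_skew {b : ℝ} {f f' g g' m n : ℝ → ℝ}
    (hf : ∀ x, HasDerivAt f (f' x) x) (hg : ∀ x, HasDerivAt g (g' x) x)
    (hm : ∀ x, HasDerivAt m (2 * f x + g x) x) (hn : ∀ x, HasDerivAt n (f x - 4 * g x) x)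
    (f2 : SqInt f) (f2' : SqInt f') (g2 : SqInt g) (g2' : SqInt g') (m2 : SqInt m)
    (n2 : SqInt n) :
    ∫ x, (f x * (m x - b * (2 * f' x + g' x)) + g x * (n x - b * (f' x - 4 * g' x))) = 0 := by
  refine integral_eq_zero_of_total_deriv
    (F := fun x => 1 / 9 * (2 * (m x * m x - b * ((2 * f x + g x) * (2 * f x + g x)))
      + (m x * n x - b * ((2 * f x + g x) * (f x - 4 * g x)))
      - (n x * n x - b * ((f x - 4 * g x) * (f x - 4 * g x)))))
    (fun x => ?_) (by fun_prop) (by fun_prop)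
  have hu := ((hf x).const_mul 2).add (hg x)
  have hv := (hf x).sub ((hg x).const_mul 4)
  have hm := hm x
  have hn := hn x
  convert! ((((((hm.mul hm).sub ((hu.mul hu).const_mul b)).const_mul 2).add
    ((hm.mul hn).sub ((hu.mul hv).const_mul b))).sub
    ((hn.mul hn).sub ((hv.mul hv).const_mul b)))).const_mul (1 / 9) using 1
  simp only [Pi.add_apply, Pi.sub_apply]
  ring

theorem eq_zero_of_rotation {p q x y : ℝ} (hp : p ≠ 0) (h1 : p * x - q * y = 0)
    (h2 : q * x + p * y = 0) : x = 0 ∧ y = 0 := by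
  have hd : p ^ 2 + q ^ 2 ≠ 0 := by positivity
  constructor
  · have : (p ^ 2 + q ^ 2) * x = 0 := by linear_combination p * h1 + q * h2
    exact (mul_eq_zero.1 this).resolve_left hd
  · have : (p ^ 2 + q ^ 2) * y = 0 := by linear_combination p * h2 - q * h1
    exact (mul_eq_zero.1 this).resolve_left hd

theorem eq_zero_of_helmholtz {b : ℝ} (hb : 0 ≤ b) {u f f' : ℝ → ℝ}
    (hu : ∀ x, HasDerivAt u (f x) x) (hf : ∀ x, HasDerivAt f (f' x) x)
    (u2 : SqInt u) (f2 : SqInt f) (h : ∀ x, u x - b * f' x = 0) (x : ℝ) :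
    f x = 0 := by
  have h0 : ∫ x, (b * (f x * f x) + u x * u x) = 0 := by
    refine integral_eq_zero_of_total_deriv (F := fun x => b * (u x * f x)) (fun x => ?_)
      (by fun_prop) (by fun_prop)
    convert! ((hu x).mul (hf x)).const_mul b using 1
    linear_combination u x * h x
  rw [integral_add (by fun_prop) (by fun_prop), integral_const_mul] at h0
  have h1 : 0 ≤ ∫ x, f x * f x := integral_nonneg fun x => mul_self_nonneg _
  have hu0 : ∀ x, u x = 0 := sqInt_eq_zero
    (continuous_iff_continuousAt.2 fun x => (hu x).continuousAt) u2
    (by linarith [mul_nonneg hb h1])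
  have : u = fun _ => 0 := funext hu0
  subst this
  exact (hu x).unique (hasDerivAt_const x 0)

/-- The linearized system, in the real and imaginary parts of coordinates that diagonalize the
Hessian, has no nonzero localized solution when the real part of the eigenvalue is nonzero. -/
theorem diagonalized_system_eq_zero {k b α γ μ ν : ℝ} (hk : 0 < k) (hb : 4 * k ^ 2 * b = 1)
    (hα : 0 < α) (hγ : 0 < γ) (hμ : μ ≠ 0)
    {f₁ f₁' f₁'' f₂ f₂' f₂'' g₁ g₁' g₁'' g₂ g₂' g₂'' m₁ m₂ n₁ n₂ : ℝ → ℝ}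
    (F₁ : IsJet f₁ f₁' f₁'') (F₂ : IsJet f₂ f₂' f₂'')
    (G₁ : IsJet g₁ g₁' g₁'') (G₂ : IsJet g₂ g₂' g₂'')
    (hm₁ : ∀ x, HasDerivAt m₁ (2 * f₁ x + g₁ x) x) (hm₂ : ∀ x, HasDerivAt m₂ (2 * f₂ x + g₂ x) x)
    (hn₁ : ∀ x, HasDerivAt n₁ (f₁ x - 4 * g₁ x) x) (hn₂ : ∀ x, HasDerivAt n₂ (f₂ x - 4 * g₂ x) x)
    (M₁ : SqInt m₁) (M₂ : SqInt m₂) (N₁ : SqInt n₁) (N₂ : SqInt n₂)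
    (ef₁ : ∀ x, α * (f₁ x - b * f₁'' x) + -3 * α * (sechSq k x * f₁ x) =
      -(μ * (m₁ x - b * (2 * f₁' x + g₁' x)) - ν * (m₂ x - b * (2 * f₂' x + g₂' x))))
    (ef₂ : ∀ x, α * (f₂ x - b * f₂'' x) + -3 * α * (sechSq k x * f₂ x) =
      -(ν * (m₁ x - b * (2 * f₁' x + g₁' x)) + μ * (m₂ x - b * (2 * f₂' x + g₂' x))))
    (eg₁ : ∀ x, γ * (g₁ x - b * g₁'' x) + 3 * α * (sechSq k x * g₁ x) =
      -(μ * (n₁ x - b * (f₁' x - 4 * g₁' x)) - ν * (n₂ x - b * (f₂' x - 4 * g₂' x))))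
    (eg₂ : ∀ x, γ * (g₂ x - b * g₂'' x) + 3 * α * (sechSq k x * g₂ x) =
      -(ν * (n₁ x - b * (f₁' x - 4 * g₁' x)) + μ * (n₂ x - b * (f₂' x - 4 * g₂' x)))) (x : ℝ) :
    f₁ x = 0 ∧ f₂ x = 0 ∧ g₁ x = 0 ∧ g₂ x = 0 := by
  have hs : SqInt (sechSq k) := sqInt_sechSq hk.ne'
  have hb0 : 0 ≤ b := by nlinarith [sq_nonneg k]
  obtain ⟨f₁d, f₁d', f₁2, f₁2', f₁2''⟩ := id F₁
  obtain ⟨f₂d, f₂d', f₂2, f₂2', f₂2''⟩ := id F₂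
  obtain ⟨g₁d, g₁d', g₁2, g₁2', g₁2''⟩ := id G₁
  obtain ⟨g₂d, g₂d', g₂2, g₂2', g₂2''⟩ := id G₂
  -- the orthogonality conditions
  have k₁ := integral_kernel_eq_zero hk.ne' hb α F₁
  have k₂ := integral_kernel_eq_zero hk.ne' hb α F₂
  have a₁ := integral_kernel_antideriv hk.ne' hb hm₁
    (fun x => ((f₁d x).const_mul 2).add (g₁d x)) M₁ (by fun_prop) (by fun_prop)
  have a₂ := integral_kernel_antideriv hk.ne' hb hm₂
    (fun x => ((f₂d x).const_mul 2).add (g₂d x)) M₂ (by fun_prop) (by fun_prop)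
  have k₁' : μ * (∫ x, Real.tanh (k * x) * sechSq k x * (m₁ x - b * (2 * f₁' x + g₁' x)))
      - ν * (∫ x, Real.tanh (k * x) * sechSq k x * (m₂ x - b * (2 * f₂' x + g₂' x))) = 0 := by
    rw [← neg_eq_zero, ← k₁, ← integral_const_mul, ← integral_const_mul,
      ← integral_sub (by fun_prop) (by fun_prop), ← integral_neg]
    congr 1; ext x; rw [ef₁]; ring
  have k₂' : ν * (∫ x, Real.tanh (k * x) * sechSq k x * (m₁ x - b * (2 * f₁' x + g₁' x)))
      + μ * (∫ x, Real.tanh (k * x) * sechSq k x * (m₂ x - b * (2 * f₂' x + g₂' x))) = 0 := by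
    rw [← neg_eq_zero, ← k₂, ← integral_const_mul, ← integral_const_mul,
      ← integral_add (by fun_prop) (by fun_prop), ← integral_neg]
    congr 1; ext x; rw [ef₂]; ring
  obtain ⟨o₁, o₂⟩ := eq_zero_of_rotation hμ k₁' k₂'
  rw [a₁] at o₁
  rw [a₂] at o₂
  have hk4 : 3 / (4 * k) ≠ 0 := by positivity
  have p₁ := form_lower_bound hk hb hα hγ f₁d F₁.continuous_one f₁2 f₁2' g₁2 g₁2'
    ((mul_eq_zero.1 o₁).resolve_left hk4)
  have p₂ := form_lower_bound hk hb hα hγ f₂d F₂.continuous_one f₂2 f₂2' g₂2 g₂2'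
    ((mul_eq_zero.1 o₂).resolve_left hk4)
  -- the energy vanishes
  have z₁ := integral_skew (b := b) f₁d g₁d hm₁ hn₁ f₁2 f₁2' g₁2 g₁2' M₁ N₁
  have z₂ := integral_skew (b := b) f₂d g₂d hm₂ hn₂ f₂2 f₂2' g₂2 g₂2' M₂ N₂
  have sf := integral_selfAdjoint (k := k) (b := b) (α := α) (β := -3 * α) F₁ F₂
  have sg := integral_selfAdjoint (k := k) (b := b) (α := γ) (β := 3 * α) G₁ G₂
  set I := ∫ x, (f₁ x * (m₂ x - b * (2 * f₂' x + g₂' x)) - f₂ x * (m₁ x - b * (2 * f₁' x + g₁' x))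
    + (g₁ x * (n₂ x - b * (f₂' x - 4 * g₂' x)) - g₂ x * (n₁ x - b * (f₁' x - 4 * g₁' x)))) with hI
  have hI0 : I = 0 := by
    have : -ν * 0 - ν * 0 - μ * I = 0 + 0 := by
      rw [hI]
      nth_rewrite 1 [← z₁]
      nth_rewrite 1 [← z₂]
      nth_rewrite 2 [← sg]
      rw [← sf, ← integral_const_mul, ← integral_const_mul, ← integral_const_mul,
        ← integral_sub (by fun_prop) (by fun_prop), ← integral_sub (by fun_prop) (by fun_prop),
        ← integral_add (by fun_prop) (by fun_prop)]
      congr 1; ext x; rw [ef₁, ef₂, eg₁, eg₂]; ring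
    have h : μ * I = 0 := by linarith
    exact (mul_eq_zero.1 h).resolve_left hμ
  have hE : ((∫ x, f₁ x * (α * (f₁ x - b * f₁'' x) + -3 * α * (sechSq k x * f₁ x)))
      + ∫ x, g₁ x * (γ * (g₁ x - b * g₁'' x) + 3 * α * (sechSq k x * g₁ x)))
      + ((∫ x, f₂ x * (α * (f₂ x - b * f₂'' x) + -3 * α * (sechSq k x * f₂ x)))
      + ∫ x, g₂ x * (γ * (g₂ x - b * g₂'' x) + 3 * α * (sechSq k x * g₂ x))) = 0 := by
    have h : (0 : ℝ) = -μ * 0 - μ * 0 + ν * I := by rw [hI0]; ring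
    rw [h, hI]
    nth_rewrite 1 [← z₁]
    nth_rewrite 1 [← z₂]
    rw [← integral_const_mul, ← integral_const_mul, ← integral_const_mul,
      ← integral_sub (by fun_prop) (by fun_prop), ← integral_add (by fun_prop) (by fun_prop),
      ← integral_add (by fun_prop) (by fun_prop), ← integral_add (by fun_prop) (by fun_prop),
      ← integral_add (by fun_prop) (by fun_prop)]
    congr 1; ext x; rw [ef₁, ef₂, eg₁, eg₂]; ring
  have hsplit : ∀ f f' : ℝ → ℝ, SqInt f → SqInt f' →
      ∫ x, (α * (b * (f' x * f' x) + f x * f x) + -3 * α * (sechSq k x * f x * f x)) =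
      α * ∫ x, (b * (f' x * f' x) + f x * f x - 3 * (sechSq k x * f x * f x)) := by
    intro f f' _ _
    rw [← integral_const_mul]
    congr 1; ext x; ring
  rw [integral_form_eq F₁, integral_form_eq F₂, integral_form_eq G₁, integral_form_eq G₂,
    hsplit _ _ f₁2 f₁2', hsplit _ _ f₂2 f₂2'] at hE
  have q₁ : 0 ≤ ∫ x, g₁ x * g₁ x := integral_nonneg fun x => mul_self_nonneg _
  have q₂ : 0 ≤ ∫ x, g₂ x * g₂ x := integral_nonneg fun x => mul_self_nonneg _
  have hq : γ * ((∫ x, g₁ x * g₁ x) + ∫ x, g₂ x * g₂ x) ≤ 0 := by linarith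
  have hq' := nonpos_of_mul_nonpos_right hq hγ
  have w₁ := sqInt_eq_zero G₁.continuous_zero g₁2 (by linarith)
  have w₂ := sqInt_eq_zero G₂.continuous_zero g₂2 (by linarith)
  -- the remaining component
  have hzero : ∀ {h h' : ℝ → ℝ}, (∀ x, HasDerivAt h (h' x) x) → (∀ x, h x = 0) →
      ∀ x, h' x = 0 := fun hd h0 x => by
    rw [funext h0] at hd
    exact (hd x).unique (hasDerivAt_const x 0)
  have d₁ := hzero g₁d w₁
  have d₂ := hzero g₂d w₂
  have c₁ := hzero g₁d' d₁
  have c₂ := hzero g₂d' d₂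
  have r : ∀ x, n₁ x - b * f₁' x = 0 ∧ n₂ x - b * f₂' x = 0 := fun x => by
    have h₁ := eg₁ x
    have h₂ := eg₂ x
    rw [w₁, c₁, d₁, d₂] at h₁
    rw [w₂, c₂, d₁, d₂] at h₂
    exact eq_zero_of_rotation (q := ν) hμ (by linarith) (by linarith)
  have hn₁' : ∀ x, HasDerivAt n₁ (f₁ x) x := fun x => by simpa [w₁ x] using hn₁ x
  have hn₂' : ∀ x, HasDerivAt n₂ (f₂ x) x := fun x => by simpa [w₂ x] using hn₂ x
  exact ⟨eq_zero_of_helmholtz hb0 hn₁' f₁d N₁ f₁2 (fun x => (r x).1) x,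
    eq_zero_of_helmholtz hb0 hn₂' f₂d N₂ f₂2 (fun x => (r x).2) x, w₁ x, w₂ x⟩

/-- The linearized system in differentiated form, in the real and imaginary parts of the
diagonalizing coordinates. -/
theorem diagonalized_deriv_system_eq_zero {k b α γ μ ν : ℝ} (hk : 0 < k)
    (hb : 4 * k ^ 2 * b = 1) (hα : 0 < α) (hγ : 0 < γ) (hμ : μ ≠ 0)
    {f₁ f₁' f₁'' f₂ f₂' f₂'' g₁ g₁' g₁'' g₂ g₂' g₂'' : ℝ → ℝ}
    (F₁ : IsJet f₁ f₁' f₁'') (F₂ : IsJet f₂ f₂' f₂'')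
    (G₁ : IsJet g₁ g₁' g₁'') (G₂ : IsJet g₂ g₂' g₂'')
    (ef₁ : ∀ x, HasDerivAt (fun y => α * (f₁ y - b * f₁'' y) + -3 * α * (sechSq k y * f₁ y))
      (-(μ * (2 * f₁ x + g₁ x - b * (2 * f₁'' x + g₁'' x))
        - ν * (2 * f₂ x + g₂ x - b * (2 * f₂'' x + g₂'' x)))) x)
    (ef₂ : ∀ x, HasDerivAt (fun y => α * (f₂ y - b * f₂'' y) + -3 * α * (sechSq k y * f₂ y))
      (-(ν * (2 * f₁ x + g₁ x - b * (2 * f₁'' x + g₁'' x))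
        + μ * (2 * f₂ x + g₂ x - b * (2 * f₂'' x + g₂'' x)))) x)
    (eg₁ : ∀ x, HasDerivAt (fun y => γ * (g₁ y - b * g₁'' y) + 3 * α * (sechSq k y * g₁ y))
      (-(μ * (f₁ x - 4 * g₁ x - b * (f₁'' x - 4 * g₁'' x))
        - ν * (f₂ x - 4 * g₂ x - b * (f₂'' x - 4 * g₂'' x)))) x)
    (eg₂ : ∀ x, HasDerivAt (fun y => γ * (g₂ y - b * g₂'' y) + 3 * α * (sechSq k y * g₂ y))
      (-(ν * (f₁ x - 4 * g₁ x - b * (f₁'' x - 4 * g₁'' x))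
        + μ * (f₂ x - 4 * g₂ x - b * (f₂'' x - 4 * g₂'' x)))) x) (x : ℝ) :
    f₁ x = 0 ∧ f₂ x = 0 ∧ g₁ x = 0 ∧ g₂ x = 0 := by
  obtain ⟨f₁d, f₁d', f₁2, f₁2', f₁2''⟩ := id F₁
  obtain ⟨f₂d, f₂d', f₂2, f₂2', f₂2''⟩ := id F₂
  obtain ⟨g₁d, g₁d', g₁2, g₁2', g₁2''⟩ := id G₁
  obtain ⟨g₂d, g₂d', g₂2, g₂2', g₂2''⟩ := id G₂
  have hd : μ ^ 2 + ν ^ 2 ≠ 0 := by positivity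
  set A₁ : ℝ → ℝ := fun y => α * (f₁ y - b * f₁'' y) + -3 * α * (sechSq k y * f₁ y) with hA₁
  set A₂ : ℝ → ℝ := fun y => α * (f₂ y - b * f₂'' y) + -3 * α * (sechSq k y * f₂ y) with hA₂
  set B₁ : ℝ → ℝ := fun y => γ * (g₁ y - b * g₁'' y) + 3 * α * (sechSq k y * g₁ y) with hB₁
  set B₂ : ℝ → ℝ := fun y => γ * (g₂ y - b * g₂'' y) + 3 * α * (sechSq k y * g₂ y) with hB₂
  have A₁2 : SqInt A₁ := by fun_prop
  have A₂2 : SqInt A₂ := by fun_prop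
  have B₁2 : SqInt B₁ := by fun_prop
  have B₂2 : SqInt B₂ := by fun_prop
  refine diagonalized_system_eq_zero (ν := ν) hk hb hα hγ hμ F₁ F₂ G₁ G₂
    (m₁ := fun y => b * (2 * f₁' y + g₁' y) - 1 / (μ ^ 2 + ν ^ 2) * (μ * A₁ y + ν * A₂ y))
    (m₂ := fun y => b * (2 * f₂' y + g₂' y) - 1 / (μ ^ 2 + ν ^ 2) * (μ * A₂ y - ν * A₁ y))
    (n₁ := fun y => b * (f₁' y - 4 * g₁' y) - 1 / (μ ^ 2 + ν ^ 2) * (μ * B₁ y + ν * B₂ y))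
    (n₂ := fun y => b * (f₂' y - 4 * g₂' y) - 1 / (μ ^ 2 + ν ^ 2) * (μ * B₂ y - ν * B₁ y))
    (fun x => ?_) (fun x => ?_) (fun x => ?_) (fun x => ?_)
    (by fun_prop) (by fun_prop) (by fun_prop) (by fun_prop)
    (fun x => ?_) (fun x => ?_) (fun x => ?_) (fun x => ?_) x
  · convert! ((((f₁d' x).const_mul 2).add (g₁d' x)).const_mul b).sub
      ((((ef₁ x).const_mul μ).add ((ef₂ x).const_mul ν)).const_mul (1 / (μ ^ 2 + ν ^ 2))) using 1
    field_simp
    ring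
  · convert! ((((f₂d' x).const_mul 2).add (g₂d' x)).const_mul b).sub
      ((((ef₂ x).const_mul μ).sub ((ef₁ x).const_mul ν)).const_mul (1 / (μ ^ 2 + ν ^ 2))) using 1
    field_simp
    ring
  · convert! (((f₁d' x).sub ((g₁d' x).const_mul 4)).const_mul b).sub
      ((((eg₁ x).const_mul μ).add ((eg₂ x).const_mul ν)).const_mul (1 / (μ ^ 2 + ν ^ 2))) using 1
    field_simp
    ring
  · convert! (((f₂d' x).sub ((g₂d' x).const_mul 4)).const_mul b).sub
      ((((eg₂ x).const_mul μ).sub ((eg₁ x).const_mul ν)).const_mul (1 / (μ ^ 2 + ν ^ 2))) using 1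
    field_simp
    ring
  · change A₁ x = _
    field_simp
    ring
  · change A₂ x = _
    field_simp
    ring
  · change B₁ x = _
    field_simp
    ring
  · change B₂ x = _
    field_simp
    ring

theorem isJet_clm_comp {v : ℝ → ℂ} (hv : ContDiff ℝ (⊤ : ℕ∞) v)
    (h : ∀ n : ℕ, Integrable (fun x : ℝ => ‖iteratedDeriv n v x‖ ^ 2)) (l : ℂ →L[ℝ] ℝ) :
    IsJet (fun x => l (v x)) (fun x => l (deriv v x)) (fun x => l (deriv (deriv v) x)) := by
  have hv1 : ContDiff ℝ (⊤ : ℕ∞) (deriv v) := (contDiff_infty_iff_deriv.1 hv).2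
  have hv2 : ContDiff ℝ (⊤ : ℕ∞) (deriv (deriv v)) := (contDiff_infty_iff_deriv.1 hv1).2
  have key : ∀ {u : ℝ → ℂ}, ContDiff ℝ (⊤ : ℕ∞) u → Integrable (fun x : ℝ => ‖u x‖ ^ 2) →
      SqInt fun x => l (u x) := fun hu hi =>
    l.comp_memLp' ((memLp_two_iff_integrable_sq_norm hu.continuous.aestronglyMeasurable).2 hi)
  refine ⟨fun x => ?_, fun x => ?_, key hv ?_, key hv1 ?_, key hv2 ?_⟩
  · exact l.hasFDerivAt.comp_hasDerivAt x (hv.differentiable (by simp) x).hasDerivAt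
  · exact l.hasFDerivAt.comp_hasDerivAt x (hv1.differentiable (by simp) x).hasDerivAt
  · simpa using h 0
  · simpa using h 1
  · simpa [iteratedDeriv_succ] using h 2

theorem exists_wave_parameter {η₀ ε w : ℝ} (hη : η₀ ∈ Set.Ioo (-(9:ℝ)/4) 0)
    (hε : ε = -1 ∨ ε = 1) (hw : w = ε * (3 + 2*η₀) / Real.sqrt (3 * (3 + η₀))) :
    ∃ B : ℝ, ε * Real.sqrt (3 / (3 + η₀)) = B ∧ 1 < B ^ 2 ∧ B ^ 2 < 4 ∧
      η₀ = 3 / B ^ 2 - 3 ∧ w = 2 / B - B := by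
  obtain ⟨h1, h2⟩ := hη
  have h3 : 0 < 3 + η₀ := by linarith
  set t := Real.sqrt (3 / (3 + η₀)) with ht
  have ht0 : 0 < t := Real.sqrt_pos.2 (by positivity)
  have ht2 : t ^ 2 = 3 / (3 + η₀) := Real.sq_sqrt (by positivity)
  have hη' : 3 + η₀ = 3 / t ^ 2 := by rw [ht2]; field_simp
  have hs : Real.sqrt (3 * (3 + η₀)) = 3 / t := by
    rw [hη', show 3 * (3 / t ^ 2) = (3 / t) ^ 2 by field_simp]
    exact Real.sqrt_sq (by positivity)
  have hε2 : ε ^ 2 = 1 := by rcases hε with rfl | rfl <;> norm_num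
  have hε0 : ε ≠ 0 := by rcases hε with rfl | rfl <;> norm_num
  refine ⟨ε * t, rfl, ?_, ?_, ?_, ?_⟩
  · rw [mul_pow, hε2, ht2, one_mul, lt_div_iff₀ h3]; linarith
  · rw [mul_pow, hε2, ht2, one_mul, div_lt_iff₀ h3]; linarith
  · rw [mul_pow, hε2, one_mul, ← hη']; ring
  · rw [hw, hs, show η₀ = 3 / t ^ 2 - 3 by linarith]
    field_simp
    linear_combination 2 * hε2

end

theorem stmt_17 (b : ℝ) (hb : 0 < b) (a c : ℝ) (ha : a = -b) (hc : c = -b)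
    (η₀ : ℝ) (hη : η₀ ∈ Set.Ioo (-(9:ℝ)/4) 0)
    (ε : ℝ) (hε : ε = -1 ∨ ε = 1)
    (w : ℝ) (hw : w = ε * (3 + 2*η₀) / Real.sqrt (3 * (3 + η₀)))
    (φ ψ : ℝ → ℝ)
    (hφ : φ = fun x => η₀ * (1 / Real.cosh (x / (2 * Real.sqrt b)))^2)
    (hψ : ψ = fun x => ε * Real.sqrt (3 / (3 + η₀)) * η₀
        * (1 / Real.cosh (x / (2 * Real.sqrt b)))^2) :
    ¬ ∃ (lam : ℂ) (v z : ℝ → ℂ),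
      0 < lam.re ∧
      (¬ ∀ x : ℝ, v x = 0 ∧ z x = 0) ∧
      ContDiff ℝ (⊤ : ℕ∞) v ∧ ContDiff ℝ (⊤ : ℕ∞) z ∧
      (∀ n : ℕ, Integrable (fun x : ℝ => ‖iteratedDeriv n v x‖^2)) ∧
      (∀ n : ℕ, Integrable (fun x : ℝ => ‖iteratedDeriv n z x‖^2)) ∧
      (∀ x : ℝ,
        -deriv (fun y : ℝ => (b : ℂ) * (w : ℂ) * deriv (deriv v) y
            + ((ψ y : ℂ) - (w : ℂ)) * v y + z y
            + (a : ℂ) * deriv (deriv z) y + (φ y : ℂ) * z y) x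
          = lam * (v x - (b : ℂ) * deriv (deriv v) x)) ∧
      (∀ x : ℝ,
        -deriv (fun y : ℝ => v y + (c : ℂ) * deriv (deriv v) y
            + (b : ℂ) * (w : ℂ) * deriv (deriv z) y
            + ((ψ y : ℂ) - (w : ℂ)) * z y) x
          = lam * (z x - (b : ℂ) * deriv (deriv z) x)) := by
  rintro ⟨lam, v, z, hlam, hne, hv, hz, iv, iz, e₁, e₂⟩
  apply hne
  obtain ⟨B, hB, hB1, hB4, rfl, rfl⟩ := exists_wave_parameter hη hε hw
  have hB0 : B ≠ 0 := by rintro rfl; norm_num at hB1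
  have hsb := Real.sqrt_pos.2 hb
  set k := 1 / (2 * Real.sqrt b) with hk
  have hk0 : 0 < k := by positivity
  have hkb : 4 * k ^ 2 * b = 1 := by
    rw [hk, div_pow, mul_pow, Real.sq_sqrt hb.le]; field_simp; norm_num
  have hφ' : φ = fun x => (3 / B ^ 2 - 3) * sechSq k x := by
    rw [hφ]; ext x; rw [sechSq_eq, hk, one_div_mul_eq_div]
  have hψ' : ψ = fun x => B * (3 / B ^ 2 - 3) * sechSq k x := by
    rw [hψ, hB]; ext x; rw [sechSq_eq, hk, one_div_mul_eq_div]
  have hs : Differentiable ℝ fun x => (sechSq k x : ℂ) := fun x =>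
    ((hasDerivAt_sechSq k x).ofReal_comp).differentiableAt
  clear hw hφ hψ
  subst ha hc hφ' hψ'
  have hv1 : ContDiff ℝ (⊤ : ℕ∞) (deriv v) := (contDiff_infty_iff_deriv.1 hv).2
  have hv2 : ContDiff ℝ (⊤ : ℕ∞) (deriv (deriv v)) := (contDiff_infty_iff_deriv.1 hv1).2
  have hz1 : ContDiff ℝ (⊤ : ℕ∞) (deriv z) := (contDiff_infty_iff_deriv.1 hz).2
  have hz2 : ContDiff ℝ (⊤ : ℕ∞) (deriv (deriv z)) := (contDiff_infty_iff_deriv.1 hz1).2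
  have dv := hv.differentiable (by simp)
  have dz := hz.differentiable (by simp)
  have dv2 := hv2.differentiable (by simp)
  have dz2 := hz2.differentiable (by simp)
  push_cast at e₁ e₂
  have hP : ∀ x, HasDerivAt _ (-(lam * (v x - (b : ℂ) * deriv (deriv v) x))) x := fun x => by
    rw [← e₁ x, neg_neg]
    exact DifferentiableAt.hasDerivAt (by fun_prop)
  have hR : ∀ x, HasDerivAt _ (-(lam * (z x - (b : ℂ) * deriv (deriv z) x))) x := fun x => by
    rw [← e₂ x, neg_neg]
    exact DifferentiableAt.hasDerivAt (by fun_prop)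
  have key := diagonalized_deriv_system_eq_zero (α := B ^ 2 - 1) (γ := 4 - B ^ 2)
    (μ := lam.re * B / 3) (ν := lam.im * B / 3) hk0 hkb (by linarith) (by linarith)
    (div_ne_zero (mul_ne_zero hlam.ne' hB0) (by norm_num))
    ((isJet_clm_comp hv iv Complex.reCLM).lin_comb (isJet_clm_comp hz iz Complex.reCLM)
      (1 / 3) (2 / (3 * B)))
    ((isJet_clm_comp hv iv Complex.imCLM).lin_comb (isJet_clm_comp hz iz Complex.imCLM)
      (1 / 3) (2 / (3 * B)))
    ((isJet_clm_comp hv iv Complex.reCLM).lin_comb (isJet_clm_comp hz iz Complex.reCLM)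
      (1 / 3) (-1 / (3 * B)))
    ((isJet_clm_comp hv iv Complex.imCLM).lin_comb (isJet_clm_comp hz iz Complex.imCLM)
      (1 / 3) (-1 / (3 * B)))
    (fun x => by
      have h := ((Complex.reCLM.hasFDerivAt.comp_hasDerivAt x (hR x)).add
        ((Complex.reCLM.hasFDerivAt.comp_hasDerivAt x (hP x)).const_mul B)).const_mul (1 / 3)
      convert! h using 1
      · ext y
        simp [← Complex.ofReal_pow]
        field_simp
        ring
      · simp
        field_simp
        ring)
    (fun x => by
      have h := ((Complex.imCLM.hasFDerivAt.comp_hasDerivAt x (hR x)).add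
        ((Complex.imCLM.hasFDerivAt.comp_hasDerivAt x (hP x)).const_mul B)).const_mul (1 / 3)
      convert! h using 1
      · ext y
        simp [← Complex.ofReal_pow]
        field_simp
        ring
      · simp
        field_simp
        ring)
    (fun x => by
      have h := (((Complex.reCLM.hasFDerivAt.comp_hasDerivAt x (hR x)).const_mul 2).sub
        ((Complex.reCLM.hasFDerivAt.comp_hasDerivAt x (hP x)).const_mul B)).const_mul (1 / 3)
      convert! h using 1
      · ext y
        simp [← Complex.ofReal_pow]
        field_simp
        ring
      · simp
        field_simp
        ring)
    (fun x => by
      have h := (((Complex.imCLM.hasFDerivAt.comp_hasDerivAt x (hR x)).const_mul 2).sub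
        ((Complex.imCLM.hasFDerivAt.comp_hasDerivAt x (hP x)).const_mul B)).const_mul (1 / 3)
      convert! h using 1
      · ext y
        simp [← Complex.ofReal_pow]
        field_simp
        ring
      · simp
        field_simp
        ring)
  intro x
  obtain ⟨k1, k2, k3, k4⟩ := key x
  simp only [Complex.reCLM_apply, Complex.imCLM_apply] at k1 k2 k3 k4
  have hv1 : (v x).re = 0 := by linear_combination k1 + 2 * k3
  have hv2 : (v x).im = 0 := by linear_combination k2 + 2 * k4
  rw [hv1] at k1
  rw [hv2] at k2
  have hB3 : 2 / (3 * B) ≠ 0 := by positivity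
  exact ⟨Complex.ext hv1 hv2, Complex.ext (by simpa [hB0] using k1) (by simpa [hB0] using k2)⟩
end
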